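/- arXiv:2306.11944 — 3 statements merged into one kernel-verified Lean document; each statement's English description precedes it below -/
import Mathlib

section
/- Fix μ > 0, a fixed y₀ ∈ Y, τ ∈ [0,1], 0 < σ ≤ 2/(L_yy + 2μ), and set ρ = max{|1 − σ(L_yy+μ)|, |1 − σμ|}. Let (x₀,y₀) ∈ X×Y and let sequences (x_k)_{k≥0} ⊆ X and (y_k)_{k≥0} ⊆ Y satisfy, for every k ≥ 1, ‖x_k − x_{k−1}‖ ≤ τ·D_X and y_k = P_Y( y_{k−1} + σ·(∇_y𝓛(x_k, y_{k−1}) − μ(y_{k−1} − y₀)) ). Then for every k ≥ 0, ‖y_k − y*_μ(x_k)‖ ≤ ρ^k·‖y₀ − y*_μ(x₀)‖ + (L_yx·ρ/(μ(1−ρ)))·τ·D_X. -/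
open scoped RealInnerProductSpace

/-- Partial gradient of `L` in the second (dual) variable. -/
noncomputable def gradY {E F : Type*} [NormedAddCommGroup F] [InnerProductSpace ℝ F]
    [CompleteSpace F] (L : E → F → ℝ) (x : E) (y : F) : F :=
  gradient (fun y' => L x y') y

/-- The regularized function `𝓛_μ(x,y) = 𝓛(x,y) − (μ/2)‖y − y₀‖²`. -/
noncomputable def Lreg {E F : Type*} [NormedAddCommGroup F] [InnerProductSpace ℝ F]
    (L : E → F → ℝ) (μ : ℝ) (y₀ : F) (x : E) (y : F) : ℝ :=
  L x y - μ / 2 * ‖y - y₀‖ ^ 2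

section RestrictedGradient

variable {F : Type*} [NormedAddCommGroup F] [InnerProductSpace ℝ F] [CompleteSpace F]

theorem HasGradientAt.hasDerivAt_comp_add_smul {f : F → ℝ} {x v f' : F} {t : ℝ}
    (h : HasGradientAt f f' (x + t • v)) :
    HasDerivAt (fun s : ℝ => f (x + s • v)) ⟪f', v⟫ t := by
  have hl : HasDerivAt (fun s : ℝ => x + s • v) v t := by
    simpa using ((hasDerivAt_id t).smul_const v).const_add x
  simpa [Function.comp_def] using h.hasFDerivAt.comp_hasDerivAt t hl

theorem ConcaveOn.le_add_inner_gradient {f : F → ℝ} (hf : ConcaveOn ℝ Set.univ f) {x f' : F}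
    (h : HasGradientAt f f' x) (y : F) : f y ≤ f x + ⟪f', y - x⟫ := by
  have hd : HasDerivAt (fun s : ℝ => f (x + s • (y - x))) ⟪f', y - x⟫ 0 :=
    HasGradientAt.hasDerivAt_comp_add_smul (by simpa using h)
  have hc : ConcaveOn ℝ Set.univ (fun s : ℝ => f (x + s • (y - x))) := by
    have := hf.comp_affineMap (AffineMap.lineMap x y)
    simpa [Function.comp_def, AffineMap.lineMap_apply, add_comm] using this
  have := hc.slope_le_of_hasDerivAt (Set.mem_univ 0) (Set.mem_univ 1) one_pos hd
  simp only [slope_def_field, sub_zero, div_one, one_smul, zero_smul, add_zero,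
    add_sub_cancel] at this
  linarith

theorem ConcaveOn.inner_gradient_sub_nonpos {f : F → ℝ} (hf : ConcaveOn ℝ Set.univ f)
    {g : F → F} (hg : ∀ y, HasGradientAt f (g y) y) (x y : F) : ⟪g x - g y, x - y⟫ ≤ 0 := by
  have h1 := hf.le_add_inner_gradient (hg x) y
  have h2 := hf.le_add_inner_gradient (hg y) x
  rw [← neg_sub x y, inner_neg_right] at h1
  rw [inner_sub_left]
  linarith

/-- The descent lemma, with the Lipschitz condition assumed only on a convex set. -/
theorem Convex.add_inner_gradient_sub_le {Y : Set F} (hY : Convex ℝ Y) {f : F → ℝ} {g : F → F}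
    (hg : ∀ y, HasGradientAt f (g y) y) {C : ℝ}
    (hlip : ∀ y ∈ Y, ∀ z ∈ Y, ‖g y - g z‖ ≤ C * ‖y - z‖) {x y : F} (hx : x ∈ Y) (hy : y ∈ Y) :
    f x + ⟪g x, y - x⟫ - C / 2 * ‖y - x‖ ^ 2 ≤ f y := by
  set v := y - x with hv
  have hd : ∀ t : ℝ, HasDerivAt
      (fun s : ℝ => f (x + s • v) - s * ⟪g x, v⟫ + s ^ 2 * (C / 2 * ‖v‖ ^ 2))
      (⟪g (x + t • v), v⟫ - ⟪g x, v⟫ + 2 * t * (C / 2 * ‖v‖ ^ 2)) t := by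
    intro t
    have h1 := (hg (x + t • v)).hasDerivAt_comp_add_smul
    have h2 := (hasDerivAt_id t).mul_const ⟪g x, v⟫
    have h3 := (hasDerivAt_pow 2 t).mul_const (C / 2 * ‖v‖ ^ 2)
    simpa using (h1.fun_sub h2).fun_add h3
  have hmono : MonotoneOn
      (fun s : ℝ => f (x + s • v) - s * ⟪g x, v⟫ + s ^ 2 * (C / 2 * ‖v‖ ^ 2)) (Set.Icc 0 1) := by
    refine monotoneOn_of_hasDerivWithinAt_nonneg (convex_Icc 0 1)
      (fun t _ => (hd t).continuousAt.continuousWithinAt)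
      (fun t _ => (hd t).hasDerivWithinAt) fun t ht => ?_
    rw [interior_Icc] at ht
    have hmem : x + t • v ∈ Y := hY.add_smul_sub_mem hx hy ⟨ht.1.le, ht.2.le⟩
    have h1 := hlip x hx _ hmem
    have h2 := real_inner_le_norm (g x - g (x + t • v)) v
    have h3 : ‖x - (x + t • v)‖ = t * ‖v‖ := by
      rw [sub_add_cancel_left, norm_neg, norm_smul, Real.norm_of_nonneg ht.1.le]
    rw [h3] at h1
    rw [inner_sub_left] at h2
    nlinarith [mul_le_mul_of_nonneg_right h1 (norm_nonneg v)]
  have := hmono (Set.left_mem_Icc.2 zero_le_one) (Set.right_mem_Icc.2 zero_le_one) zero_le_one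
  simp only [zero_smul, add_zero, one_smul, hv, add_sub_cancel] at this
  linarith

/-- The Baillon–Haddad inequality for the component of the gradient in a subspace, when the
Lipschitz condition holds on a convex set containing large enough balls of that subspace
around both points. -/
theorem ConcaveOn.norm_sq_starProjection_gradient_sub_le {f : F → ℝ}
    (hf : ConcaveOn ℝ Set.univ f) {g : F → F} (hg : ∀ y, HasGradientAt f (g y) y)
    {Y : Set F} (hY : Convex ℝ Y) {C : ℝ} (hC : 0 ≤ C)
    (hlip : ∀ y ∈ Y, ∀ z ∈ Y, ‖g y - g z‖ ≤ C * ‖y - z‖)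
    (V : Submodule ℝ F) [V.HasOrthogonalProjection] {x z : F}
    (hx : ∀ v ∈ V, ‖v‖ ≤ ‖x - z‖ → x + v ∈ Y) (hz : ∀ v ∈ V, ‖v‖ ≤ ‖x - z‖ → z + v ∈ Y) :
    ‖V.starProjection (g x - g z)‖ ^ 2 ≤ -(C * ⟪g x - g z, x - z⟫) := by
  have hxY : x ∈ Y := by simpa using hx 0 V.zero_mem (by simp)
  have hzY : z ∈ Y := by simpa using hz 0 V.zero_mem (by simp)
  have hle : ‖V.starProjection (g x - g z)‖ ≤ C * ‖x - z‖ :=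
    (V.norm_starProjection_apply_le _).trans (hlip x hxY z hzY)
  obtain rfl | hC := hC.eq_or_lt
  · rw [zero_mul] at hle
    rw [le_antisymm hle (norm_nonneg _)]
    simp
  have half : ∀ a b : F, (∀ v ∈ V, ‖v‖ ≤ ‖x - z‖ → b + v ∈ Y) → b ∈ Y →
      ‖V.starProjection (g b - g a)‖ ≤ C * ‖x - z‖ →
      ‖V.starProjection (g b - g a)‖ ^ 2 ≤ 2 * C * (f a + ⟪g a, b - a⟫ - f b) := by
    intro a b hb hbY hab
    set d := V.starProjection (g b - g a) with hd
    have hdV : d ∈ V := V.starProjection_apply_mem _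
    have hw : b + C⁻¹ • d ∈ Y := by
      refine hb _ (V.smul_mem _ hdV) ?_
      rw [norm_smul, Real.norm_of_nonneg (by positivity), inv_mul_le_iff₀ hC]
      exact hab
    have h1 := hf.le_add_inner_gradient (hg a) (b + C⁻¹ • d)
    have h2 := hY.add_inner_gradient_sub_le hg hlip hbY hw
    have h3 : ⟪g b - g a, d⟫ = ‖d‖ ^ 2 := by
      have := V.starProjection_inner_eq_zero (g b - g a) d hdV
      rw [← hd, inner_sub_left, real_inner_self_eq_norm_sq] at this
      linarith
    rw [inner_sub_left] at h3
    rw [add_sub_cancel_left, norm_smul, inner_smul_right, mul_pow,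
      Real.norm_of_nonneg (by positivity)] at h2
    rw [add_sub_right_comm, inner_add_right, inner_smul_right] at h1
    have h4 : f b + C⁻¹ * ‖d‖ ^ 2 - C / 2 * (C⁻¹ ^ 2 * ‖d‖ ^ 2) ≤ f a + ⟪g a, b - a⟫ := by
      linear_combination h1 + h2 - C⁻¹ * h3
    have h5 : C⁻¹ * ‖d‖ ^ 2 - C / 2 * (C⁻¹ ^ 2 * ‖d‖ ^ 2) = ‖d‖ ^ 2 / (2 * C) := by
      field_simp
      ring
    have h6 : ‖d‖ ^ 2 / (2 * C) ≤ f a + ⟪g a, b - a⟫ - f b := by linarith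
    rw [div_le_iff₀ (by positivity)] at h6
    linarith
  have hneg : ‖V.starProjection (g z - g x)‖ = ‖V.starProjection (g x - g z)‖ := by
    rw [← neg_sub, map_neg, norm_neg]
  have h1 := half z x hx hxY hle
  have h2 := half x z hz hzY (hneg ▸ hle)
  rw [hneg, ← neg_sub x z, inner_neg_right] at h2
  rw [inner_sub_left]
  linarith

/-- A gradient ascent step, restricted to a subspace, is a `c`-Lipschitz map at pairs of points
surrounded by large enough balls of that subspace. -/
theorem ConcaveOn.norm_gradient_step_sub_le_of_balls {f : F → ℝ}
    (hf : ConcaveOn ℝ Set.univ f) {g : F → F} (hg : ∀ y, HasGradientAt f (g y) y)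
    {Y : Set F} (hY : Convex ℝ Y) {C : ℝ} (hC : 0 ≤ C)
    (hlip : ∀ y ∈ Y, ∀ z ∈ Y, ‖g y - g z‖ ≤ C * ‖y - z‖)
    (V : Submodule ℝ F) [V.HasOrthogonalProjection] {c s : ℝ} (hc : 0 ≤ c) (hs : 0 ≤ s)
    (hsc : s * C ≤ 2 * c) {x z : F} (hxz : x - z ∈ V)
    (hx : ∀ v ∈ V, ‖v‖ ≤ ‖x - z‖ → x + v ∈ Y) (hz : ∀ v ∈ V, ‖v‖ ≤ ‖x - z‖ → z + v ∈ Y) :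
    ‖c • (x - z) + s • V.starProjection (g x - g z)‖ ≤ c * ‖x - z‖ := by
  have h1 := hf.norm_sq_starProjection_gradient_sub_le hg hY hC hlip V hx hz
  have h2 := hf.inner_gradient_sub_nonpos hg x z
  have h3 : ⟪x - z, V.starProjection (g x - g z)⟫ = ⟪g x - g z, x - z⟫ := by
    have := V.starProjection_inner_eq_zero (g x - g z) (x - z) hxz
    rw [inner_sub_left] at this
    rw [real_inner_comm]
    linarith
  refine (sq_le_sq₀ (norm_nonneg _) (by positivity)).1 ?_
  rw [norm_add_sq_real, inner_smul_left, inner_smul_right, h3, norm_smul, norm_smul,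
    Real.norm_of_nonneg hc, Real.norm_of_nonneg hs]
  simp only [conj_trivial]
  nlinarith [mul_le_mul_of_nonneg_left h1 (sq_nonneg s),
    mul_nonneg (mul_nonneg hs (sub_nonneg.2 hsc)) (neg_nonneg.2 h2)]

/-- The same estimate for arbitrary pairs of points surrounded by balls of a common radius. -/
theorem ConcaveOn.norm_gradient_step_sub_le_of_uniform_balls {f : F → ℝ}
    (hf : ConcaveOn ℝ Set.univ f) {g : F → F} (hg : ∀ y, HasGradientAt f (g y) y)
    {Y : Set F} (hY : Convex ℝ Y) {C : ℝ} (hC : 0 ≤ C)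
    (hlip : ∀ y ∈ Y, ∀ z ∈ Y, ‖g y - g z‖ ≤ C * ‖y - z‖)
    (V : Submodule ℝ F) [V.HasOrthogonalProjection] {c s : ℝ} (hc : 0 ≤ c) (hs : 0 ≤ s)
    (hsc : s * C ≤ 2 * c) {x z : F} (hxz : x - z ∈ V) {r : ℝ} (hr : 0 < r)
    (hx : ∀ v ∈ V, ‖v‖ ≤ r → x + v ∈ Y) (hz : ∀ v ∈ V, ‖v‖ ≤ r → z + v ∈ Y) :
    ‖c • (x - z) + s • V.starProjection (g x - g z)‖ ≤ c * ‖x - z‖ := by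
  obtain ⟨n, hn⟩ := exists_nat_gt (‖x - z‖ / r)
  have hn0 : (0 : ℝ) < n := lt_of_le_of_lt (by positivity) hn
  have hnr : ‖x - z‖ / n ≤ r := by
    rw [div_lt_iff₀ hr] at hn
    rw [div_le_iff₀ hn0]
    linarith
  let p : ℕ → F := fun i => z + ((i : ℝ) / n) • (x - z)
  have hstep : ∀ i, p (i + 1) - p i = (n : ℝ)⁻¹ • (x - z) := by
    intro i
    simp only [p, add_sub_add_left_eq_sub, ← sub_smul]
    congr 1
    push_cast
    field_simp
    ring
  have hnorm : ∀ i, ‖p (i + 1) - p i‖ = ‖x - z‖ / n := by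
    intro i
    rw [hstep, norm_smul, Real.norm_of_nonneg (by positivity)]
    ring
  have hball : ∀ i ≤ n, ∀ v ∈ V, ‖v‖ ≤ r → p i + v ∈ Y := by
    intro i hi v hv hvr
    have hin : (i : ℝ) / n ≤ 1 := (div_le_one hn0).2 (by exact_mod_cast hi)
    have := hY.add_smul_sub_mem (hz v hv hvr) (hx v hv hvr) ⟨by positivity, hin⟩
    convert this using 1
    simp only [p, add_sub_add_right_eq_sub]
    abel
  have hind : ∀ i ≤ n, ‖c • (p i - z) + s • V.starProjection (g (p i) - g z)‖
      ≤ i * (c * (‖x - z‖ / n)) := by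
    intro i
    induction i with
    | zero => simp [p]
    | succ i ih =>
      intro hi
      have h1 := ih (by omega)
      have h2 := hf.norm_gradient_step_sub_le_of_balls hg hY hC hlip V hc hs hsc
        (x := p (i + 1)) (z := p i) (hstep i ▸ V.smul_mem _ hxz)
        (fun v hv hvn => hball _ hi v hv (hvn.trans (hnorm i ▸ hnr)))
        (fun v hv hvn => hball _ (by omega) v hv (hvn.trans (hnorm i ▸ hnr)))
      rw [hnorm] at h2
      have h3 : c • (p (i + 1) - z) + s • V.starProjection (g (p (i + 1)) - g z)
          = (c • (p i - z) + s • V.starProjection (g (p i) - g z))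
            + (c • (p (i + 1) - p i) + s • V.starProjection (g (p (i + 1)) - g (p i))) := by
        simp only [map_sub, smul_sub]
        abel
      rw [h3]
      refine (norm_add_le _ _).trans ?_
      push_cast
      linarith
  have hpn : p n = x := by simp [p, div_self hn0.ne']
  have := hind n le_rfl
  rw [hpn] at this
  refine this.trans_eq ?_
  field_simp

end RestrictedGradient

/-- A nonempty convex set in finite dimension contains a ball relative to its affine span. -/
theorem Convex.exists_ball_vectorSpan_subset {F : Type*} [NormedAddCommGroup F]
    [InnerProductSpace ℝ F] [FiniteDimensional ℝ F] {Y : Set F} (hY : Convex ℝ Y)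
    (hne : Y.Nonempty) :
    ∃ c ∈ Y, ∃ r > 0, ∀ v ∈ vectorSpan ℝ Y, ‖v‖ ≤ r → c + v ∈ Y := by
  obtain ⟨c, hc⟩ := hne.intrinsicInterior hY
  have hcY := intrinsicInterior_subset hc
  obtain ⟨c', hc', rfl⟩ := mem_intrinsicInterior.1 hc
  obtain ⟨r, hr, hball⟩ := Metric.isOpen_iff.1 isOpen_interior _ hc'
  refine ⟨c', hcY, r / 2, half_pos hr, fun v hv hvr => ?_⟩
  have hmem : (c' : F) + v ∈ affineSpan ℝ Y := by
    rw [add_comm]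
    exact AffineSubspace.vadd_mem_of_mem_direction
      (by rwa [direction_affineSpan]) c'.2
  have : (⟨c' + v, hmem⟩ : affineSpan ℝ Y) ∈ Metric.ball c' r := by
    rw [Metric.mem_ball, Subtype.dist_eq, dist_eq_norm]
    simp only [add_sub_cancel_left]
    linarith
  have hmemint := hball this
  exact (interior_subset hmemint : _ ∈ Subtype.val ⁻¹' Y)

section FiniteDimensional

variable {F : Type*} [NormedAddCommGroup F] [InnerProductSpace ℝ F] [FiniteDimensional ℝ F]

/-- The component of a gradient ascent step along a convex set is `c`-Lipschitz on this set. -/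
theorem ConcaveOn.norm_gradient_step_sub_le {f : F → ℝ}
    (hf : ConcaveOn ℝ Set.univ f) {g : F → F} (hg : ∀ y, HasGradientAt f (g y) y)
    {Y : Set F} (hY : Convex ℝ Y) {C : ℝ} (hC : 0 ≤ C)
    (hlip : ∀ y ∈ Y, ∀ z ∈ Y, ‖g y - g z‖ ≤ C * ‖y - z‖) {c s : ℝ} (hc : 0 ≤ c) (hs : 0 ≤ s)
    (hsc : s * C ≤ 2 * c) {x z : F} (hx : x ∈ Y) (hz : z ∈ Y) :
    ‖c • (x - z) + s • (vectorSpan ℝ Y).starProjection (g x - g z)‖ ≤ c * ‖x - z‖ := by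
  obtain ⟨o, ho, r, hr, hball⟩ := hY.exists_ball_vectorSpan_subset ⟨x, hx⟩
  have hgc : ContinuousOn g Y :=
    (LipschitzOnWith.of_dist_le_mul (K := C.toNNReal) fun y hy z hz => by
      simpa [dist_eq_norm, hC] using hlip y hy z hz).continuousOn
  have hpath : ∀ y : F, y ∈ Y → ∀ t ∈ Set.Icc (0 : ℝ) 1, y + t • (o - y) ∈ Y :=
    fun y hy t ht => hY.add_smul_sub_mem hy ho ht
  have hlim : ∀ y : F,
      Filter.Tendsto (fun t : ℝ => y + t • (o - y)) (nhdsWithin 0 (Set.Ioc 0 1)) (nhds y) := by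
    intro y
    have : Continuous (fun t : ℝ => y + t • (o - y)) := by fun_prop
    simpa using (this.tendsto 0).mono_left nhdsWithin_le_nhds
  have hglim : ∀ y : F, y ∈ Y →
      Filter.Tendsto (fun t : ℝ => g (y + t • (o - y))) (nhdsWithin 0 (Set.Ioc 0 1))
        (nhds (g y)) := by
    intro y hy
    refine (hgc y hy).tendsto.comp (tendsto_nhdsWithin_iff.2 ⟨hlim y, ?_⟩)
    filter_upwards [self_mem_nhdsWithin] with t ht
    exact hpath y hy t ⟨ht.1.le, ht.2⟩
  have hsub := (hlim x).sub (hlim z)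
  have hproj := (((vectorSpan ℝ Y).starProjection.continuous.tendsto _).comp
    ((hglim x hx).sub (hglim z hz)))
  have hbot : (nhdsWithin (0 : ℝ) (Set.Ioc 0 1)).NeBot := by
    rw [← mem_closure_iff_nhdsWithin_neBot, closure_Ioc zero_ne_one]
    exact Set.left_mem_Icc.2 zero_le_one
  refine le_of_tendsto_of_tendsto ((hsub.const_smul c).add (hproj.const_smul s)).norm
    (hsub.norm.const_mul c) ?_
  filter_upwards [self_mem_nhdsWithin] with t ht
  have hballt : ∀ y ∈ Y, ∀ v ∈ vectorSpan ℝ Y, ‖v‖ ≤ t * r → y + t • (o - y) + v ∈ Y := by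
    intro y hy v hv hvr
    have hmem : o + t⁻¹ • v ∈ Y := by
      refine hball _ (Submodule.smul_mem _ _ hv) ?_
      rw [norm_smul, Real.norm_of_nonneg (inv_nonneg.2 ht.1.le), inv_mul_le_iff₀ ht.1]
      exact hvr
    have := hY.add_smul_sub_mem hy hmem ⟨ht.1.le, ht.2⟩
    convert this using 1
    rw [add_sub_right_comm, smul_add, smul_inv_smul₀ ht.1.ne', add_assoc]
  exact hf.norm_gradient_step_sub_le_of_uniform_balls hg hY hC hlip _ hc hs hsc
    (vsub_mem_vectorSpan ℝ (hpath x hx t ⟨ht.1.le, ht.2⟩) (hpath z hz t ⟨ht.1.le, ht.2⟩))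
    (mul_pos ht.1 hr) (hballt x hx) (hballt z hz)

/-- One projected gradient ascent step for a regularized concave function contracts the distance
to the maximizer by the factor `1 - σ * μ`. -/
theorem ConcaveOn.norm_projected_gradient_step_sub_le {f : F → ℝ}
    (hf : ConcaveOn ℝ Set.univ f) {g : F → F} (hg : ∀ y, HasGradientAt f (g y) y)
    {Y : Set F} (hY : Convex ℝ Y) {C : ℝ} (hC : 0 ≤ C)
    (hlip : ∀ y ∈ Y, ∀ z ∈ Y, ‖g y - g z‖ ≤ C * ‖y - z‖) {μ σ : ℝ} (hσ : 0 ≤ σ)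
    (hσμ : σ * μ ≤ 1) (hσC : σ * C ≤ 2 * (1 - σ * μ)) {o y p q : F} (hy : y ∈ Y) (hp : p ∈ Y)
    (hq : q ∈ Y) (hopt : ⟪g q - μ • (q - o), p - q⟫ ≤ 0)
    (hproj : ⟪y + σ • (g y - μ • (y - o)) - p, q - p⟫ ≤ 0) :
    ‖p - q‖ ≤ (1 - σ * μ) * ‖y - q‖ := by
  set V := vectorSpan ℝ Y
  have hpq : p - q ∈ V := vsub_mem_vectorSpan ℝ hp hq
  have hstep := hf.norm_gradient_step_sub_le hg hY hC hlip (sub_nonneg.2 hσμ) hσ hσC hy hq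
  have h1 : ‖p - q‖ ^ 2 ≤ ⟪(1 - σ * μ) • (y - q) + σ • V.starProjection (g y - g q), p - q⟫ := by
    have h2 : ⟪V.starProjection (g y - g q), p - q⟫ = ⟪g y - g q, p - q⟫ := by
      have := V.starProjection_inner_eq_zero (g y - g q) (p - q) hpq
      rw [inner_sub_left] at this
      linarith
    rw [inner_add_left, real_inner_smul_left, real_inner_smul_left, h2]
    have h3 : y + σ • (g y - μ • (y - o)) - p
        = (1 - σ * μ) • (y - q) + σ • (g y - g q) + σ • (g q - μ • (q - o)) - (p - q) := by
      module
    rw [h3, ← neg_sub p q, inner_neg_right, inner_sub_left, inner_add_left, inner_add_left,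
      real_inner_smul_left, real_inner_smul_left, real_inner_smul_left,
      real_inner_self_eq_norm_sq] at hproj
    nlinarith [mul_nonneg hσ (neg_nonneg.2 hopt)]
  have h4 := h1.trans (real_inner_le_norm _ _)
  rw [sq] at h4
  obtain h0 | h0 := (norm_nonneg (p - q)).eq_or_lt
  · rw [← h0]
    exact mul_nonneg (sub_nonneg.2 hσμ) (norm_nonneg _)
  · exact (le_of_mul_le_mul_right h4 h0).trans hstep

/-- First-order optimality for the maximizer of a regularized function over a convex set. -/
theorem HasGradientAt.inner_sub_nonpos_of_isMaxOn_regularized {f : F → ℝ} {Y : Set F}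
    (hY : Convex ℝ Y) {μ : ℝ} {o q f' : F} (hg : HasGradientAt f f' q) (hq : q ∈ Y)
    (hmax : IsMaxOn (fun y => f y - μ / 2 * ‖y - o‖ ^ 2) Y q) {z : F} (hz : z ∈ Y) :
    ⟪f' - μ • (q - o), z - q⟫ ≤ 0 := by
  have hn : HasFDerivAt (fun y : F => ‖y - o‖ ^ 2) (2 • innerSL ℝ (q - o)) q := by
    simpa using ((hasFDerivAt_id q).sub_const o).norm_sq
  have hd := (hg.hasFDerivAt.sub (hn.const_mul (μ / 2))).hasFDerivWithinAt (s := Y)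
  have hle := hmax.localize.hasFDerivWithinAt_nonpos hd
    (sub_mem_posTangentConeAt_of_segment_subset (hY.segment_subset hq hz))
  have heq : (InnerProductSpace.toDual ℝ F f' - (μ / 2) • 2 • innerSL ℝ (q - o)) (z - q)
      = ⟪f' - μ • (q - o), z - q⟫ := by
    simp [inner_sub_left, real_inner_smul_left]
    ring
  rwa [heq] at hle

/-- Lipschitz dependence of the regularized maximizer on the gradient field. -/
theorem norm_sub_le_of_regularized_optimality {f : F → ℝ} (hf : ConcaveOn ℝ Set.univ f)
    {g h : F → F} (hg : ∀ y, HasGradientAt f (g y) y) {μ : ℝ} (hμ : 0 < μ) {o p q : F}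
    (hp : ⟪g p - μ • (p - o), q - p⟫ ≤ 0) (hq : ⟪h q - μ • (q - o), p - q⟫ ≤ 0) :
    ‖p - q‖ ≤ ‖g q - h q‖ / μ := by
  have h1 := hf.inner_gradient_sub_nonpos hg p q
  have h2 : μ * ‖p - q‖ ^ 2 ≤ ⟪g q - h q, p - q⟫ := by
    have h3 : g p - μ • (p - o)
        = (g p - g q) + (g q - h q) + (h q - μ • (q - o)) - μ • (p - q) := by module
    rw [h3, ← neg_sub p q, inner_neg_right, inner_sub_left, inner_add_left, inner_add_left,
      real_inner_smul_left, real_inner_self_eq_norm_sq] at hp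
    linarith
  have h4 := h2.trans (real_inner_le_norm _ _)
  rw [le_div_iff₀ hμ]
  obtain h0 | h0 := (norm_nonneg (p - q)).eq_or_lt
  · rw [← h0, zero_mul]
    exact norm_nonneg _
  · refine le_of_mul_le_mul_right ?_ h0
    linarith

end FiniteDimensional

/-- A sequence contracted by `ρ` after a perturbation of size at most `M` at each step. -/
theorem le_pow_mul_add_of_le_mul_add {e : ℕ → ℝ} {ρ M : ℝ} (hρ0 : 0 ≤ ρ) (hρ1 : ρ < 1)
    (hM : 0 ≤ M) (h : ∀ k, e (k + 1) ≤ ρ * (e k + M)) (k : ℕ) :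
    e k ≤ ρ ^ k * e 0 + ρ / (1 - ρ) * M := by
  have h1 : 0 < 1 - ρ := sub_pos.2 hρ1
  induction k with
  | zero =>
    have : 0 ≤ ρ / (1 - ρ) * M := by positivity
    simpa using this
  | succ k ih =>
    refine (h k).trans ((mul_le_mul_of_nonneg_left (add_le_add_left ih M) hρ0).trans_eq ?_)
    field_simp
    ring

/-- Lemma `lem:rate-y`: along CG-RPGA-type iterates,
`‖y_k − y*_μ(x_k)‖ ≤ ρ^k‖y₀ − y*_μ(x₀)‖ + (L_yx ρ/(μ(1−ρ)))·τ·D_X`. -/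
theorem stmt_12 {E F : Type*}
    [NormedAddCommGroup E] [InnerProductSpace ℝ E] [FiniteDimensional ℝ E]
    [NormedAddCommGroup F] [InnerProductSpace ℝ F] [FiniteDimensional ℝ F]
    (X : Set E) (Y : Set F)
    (hXne : X.Nonempty) (hXconv : Convex ℝ X) (hXcomp : IsCompact X)
    (hYne : Y.Nonempty) (hYconv : Convex ℝ Y) (hYcomp : IsCompact Y)
    (L : E → F → ℝ) (hLdiff : Differentiable ℝ (fun p : E × F => L p.1 p.2))
    (Lyy Lyx : ℝ) (hLyy : 0 ≤ Lyy) (hLyx : 0 < Lyx)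
    (hlipy : ∀ x ∈ X, ∀ x' ∈ X, ∀ y ∈ Y, ∀ y' ∈ Y,
      ‖gradY L x y - gradY L x' y'‖ ≤ Lyx * ‖x - x'‖ + Lyy * ‖y - y'‖)
    (hconc : ∀ x ∈ X, ConcaveOn ℝ Set.univ (L x))
    (P : F → F)
    (hP : ∀ u : F, P u ∈ Y ∧ ∀ z ∈ Y, ⟪u - P u, z - P u⟫ ≤ 0)
    (μ : ℝ) (hμ : 0 < μ)
    (τ : ℝ) (hτ : τ ∈ Set.Icc (0 : ℝ) 1)
    (σ : ℝ) (hσ0 : 0 < σ) (hσ : σ ≤ 2 / (Lyy + 2 * μ))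
    (ρ : ℝ) (hρ : ρ = max |1 - σ * (Lyy + μ)| |1 - σ * μ|)
    (xseq : ℕ → E) (yseq : ℕ → F)
    (hxseq : ∀ k : ℕ, xseq k ∈ X) (hy0 : yseq 0 ∈ Y)
    (ystar : E → F)
    (hystar : ∀ x ∈ X, ystar x ∈ Y ∧
      ∀ y ∈ Y, Lreg L μ (yseq 0) x y ≤ Lreg L μ (yseq 0) x (ystar x))
    (hxstep : ∀ k : ℕ, 1 ≤ k → ‖xseq k - xseq (k - 1)‖ ≤ τ * Metric.diam X)
    (hyrec : ∀ k : ℕ, 1 ≤ k → yseq k =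
      P (yseq (k - 1) + σ • (gradY L (xseq k) (yseq (k - 1))
        - μ • (yseq (k - 1) - yseq 0)))) :
    ∀ k : ℕ, ‖yseq k - ystar (xseq k)‖ ≤
      ρ ^ k * ‖yseq 0 - ystar (xseq 0)‖
      + Lyx * ρ / (μ * (1 - ρ)) * τ * Metric.diam X := by
  have hD : 0 ≤ τ * Metric.diam X := mul_nonneg hτ.1 Metric.diam_nonneg
  have hσ' : σ * (Lyy + 2 * μ) ≤ 2 := (le_div_iff₀ (by positivity)).1 hσ
  have hσμ : 0 < σ * μ := mul_pos hσ0 hμ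
  have hσL : 0 ≤ σ * Lyy := mul_nonneg hσ0.le hLyy
  have hρ' : ρ = 1 - σ * μ := by
    rw [hρ, abs_of_nonneg (by linarith : 0 ≤ 1 - σ * μ)]
    exact max_eq_right (abs_le.2 ⟨by linarith, by linarith⟩)
  have hgrad : ∀ x y, HasGradientAt (L x) (gradY L x y) y := by
    intro x y
    have : DifferentiableAt ℝ (L x) y :=
      (hLdiff (x, y)).comp y ((differentiableAt_const x).prodMk differentiableAt_id)
    exact this.hasGradientAt
  have hopt : ∀ x ∈ X, ∀ z ∈ Y,
      ⟪gradY L x (ystar x) - μ • (ystar x - yseq 0), z - ystar x⟫ ≤ 0 := fun x hx z hz =>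
    (hgrad x _).inner_sub_nonpos_of_isMaxOn_regularized hYconv (hystar x hx).1
      (fun y hy => (hystar x hx).2 y hy) hz
  have hlip : ∀ x ∈ X, ∀ y ∈ Y, ∀ z ∈ Y, ‖gradY L x y - gradY L x z‖ ≤ Lyy * ‖y - z‖ := by
    intro x hx y hy z hz
    simpa using hlipy x hx x hx y hy z hz
  have hyY : ∀ k, yseq k ∈ Y
    | 0 => hy0
    | k + 1 => hyrec (k + 1) (by omega) ▸ (hP _).1
  have hstar : ∀ x ∈ X, ∀ x' ∈ X, ‖ystar x - ystar x'‖ ≤ Lyx * ‖x - x'‖ / μ := by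
    intro x hx x' hx'
    have hx'Y := (hystar x' hx').1
    refine (norm_sub_le_of_regularized_optimality (hconc x hx) (hgrad x) hμ
      (hopt x hx _ hx'Y) (hopt x' hx' _ (hystar x hx).1)).trans ?_
    gcongr
    simpa using hlipy x hx x' hx' _ hx'Y _ hx'Y
  have hrec : ∀ k, ‖yseq (k + 1) - ystar (xseq (k + 1))‖
      ≤ ρ * (‖yseq k - ystar (xseq k)‖ + Lyx * (τ * Metric.diam X) / μ) := by
    intro k
    have hx := hxseq (k + 1)
    have hs := (hystar _ hx).1
    have hproj := (hP (yseq k + σ • (gradY L (xseq (k + 1)) (yseq k)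
        - μ • (yseq k - yseq 0)))).2 _ hs
    have hk := hyrec (k + 1) (by omega)
    rw [Nat.add_sub_cancel] at hk
    rw [← hk] at hproj
    have h1 := (hconc _ hx).norm_projected_gradient_step_sub_le (hgrad _) hYconv hLyy
      (hlip _ hx) hσ0.le (by linarith) (by linarith) (hyY k) (hyY (k + 1)) hs
      (hopt _ hx _ (hyY (k + 1))) hproj
    rw [← hρ'] at h1
    have hdist : ‖xseq k - xseq (k + 1)‖ ≤ τ * Metric.diam X := by
      simpa [norm_sub_rev] using hxstep (k + 1) (by omega)
    have h2 : ‖ystar (xseq k) - ystar (xseq (k + 1))‖ ≤ Lyx * (τ * Metric.diam X) / μ :=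
      (hstar _ (hxseq k) _ hx).trans (by gcongr)
    refine h1.trans (mul_le_mul_of_nonneg_left ?_ (by linarith))
    exact (norm_sub_le_norm_sub_add_norm_sub _ _ _).trans (add_le_add_right h2 _)
  intro k
  have hρ0 : 0 ≤ ρ := by linarith
  have hρ1 : ρ < 1 := by linarith
  refine (le_pow_mul_add_of_le_mul_add (e := fun k => ‖yseq k - ystar (xseq k)‖) hρ0 hρ1
    (by positivity) hrec k).trans_eq ?_
  congr 1
  have : 1 - ρ ≠ 0 := (sub_pos.2 hρ1).ne'
  field_simp
end

section
/- Fix μ > 0, a fixed y₀ ∈ Y, τ ∈ [0,1], 0 < σ ≤ 2/(L_yy + 2μ), and set ρ = max{|1 − σ(L_yy+μ)|, |1 − σμ|}. Let (x₀,y₀) ∈ X×Y and let sequences (x_k)_{k≥0} ⊆ X and (y_k)_{k≥0} ⊆ Y satisfy, for every k ≥ 1, ‖x_k − x_{k−1}‖ ≤ τ·D_X and y_k = P_Y( y_{k−1} + σ·(∇_y𝓛(x_k, y_{k−1}) − μ(y_{k−1} − y₀)) ). Then for every k ≥ 0, ‖y_{k+1} − y_k‖ ≤ 2·ρ^k·‖y₀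 − y*_μ(x₀)‖ + (2·L_yx·ρ/(μ(1−ρ)))·τ·D_X + (L_yx/μ)·τ·D_X. -/
open scoped RealInnerProductSpace

section LinePath

variable {F : Type*} [NormedAddCommGroup F] [InnerProductSpace ℝ F] [CompleteSpace F]

theorem HasGradientAt.hasDerivAt_line {f : F → ℝ} {v y d : F} {t : ℝ}
    (hf : HasGradientAt f v (y + t • d)) :
    HasDerivAt (fun s : ℝ => f (y + s • d)) ⟪v, d⟫ t := by
  have hline : HasDerivAt (fun s : ℝ => y + s • d) d t := by
    simpa using ((hasDerivAt_id t).smul_const d).const_add y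
  exact hf.hasFDerivAt.comp_hasDerivAt t hline

/-- The gradient of a concave function is a supergradient. -/
theorem ConcaveOn.sub_le_inner_of_hasGradientAt {f : F → ℝ} (hf : ConcaveOn ℝ Set.univ f)
    {v y : F} (hv : HasGradientAt f v y) (z : F) : f z - f y ≤ ⟪v, z - y⟫ := by
  have hconc : ConcaveOn ℝ Set.univ (fun s : ℝ => f (y + s • (z - y))) := by
    refine ⟨convex_univ, fun s _ t _ a b ha hb hab => ?_⟩
    have h := hf.2 (Set.mem_univ (y + s • (z - y))) (Set.mem_univ (y + t • (z - y))) ha hb hab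
    have he : a • (y + s • (z - y)) + b • (y + t • (z - y))
        = y + (a • s + b • t) • (z - y) := by
      obtain rfl : a = 1 - b := by linarith
      simp only [smul_eq_mul]
      module
    rwa [he] at h
  have hd : HasDerivAt (fun s : ℝ => f (y + s • (z - y))) ⟪v, z - y⟫ 0 :=
    HasGradientAt.hasDerivAt_line (by simpa using hv)
  have h := hconc.slope_le_of_hasDerivAt (Set.mem_univ 0) (Set.mem_univ 1) one_pos hd
  simpa [slope_def_field] using h

/-- The lower half of the descent lemma, for a gradient that is Lipschitz on a convex set. -/
theorem inner_sub_le_of_lipschitz_gradient {f : F → ℝ} {g : F → F}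
    (hg : ∀ y, HasGradientAt f (g y) y) {Y : Set F} (hY : Convex ℝ Y) {K : ℝ}
    (hlip : ∀ y ∈ Y, ∀ y' ∈ Y, ‖g y - g y'‖ ≤ K * ‖y - y'‖) {y z : F} (hy : y ∈ Y) (hz : z ∈ Y) :
    ⟪g y, z - y⟫ - K / 2 * ‖z - y‖ ^ 2 ≤ f z - f y := by
  set d := z - y with hd
  have hderiv : ∀ t : ℝ, HasDerivAt
      (fun s : ℝ => f (y + s • d) - s * ⟪g y, d⟫ + K / 2 * ‖d‖ ^ 2 * s ^ 2)
      (⟪g (y + t • d), d⟫ - ⟪g y, d⟫ + K * ‖d‖ ^ 2 * t) t := fun t => by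
    have h := (((hg (y + t • d)).hasDerivAt_line).sub
      ((hasDerivAt_id t).mul_const ⟪g y, d⟫)).add
      ((hasDerivAt_pow 2 t).const_mul (K / 2 * ‖d‖ ^ 2))
    refine (h.congr_deriv ?_).congr_of_eventuallyEq (Filter.Eventually.of_forall fun s => ?_)
    · simp
      ring
    · simp
  have hmono : MonotoneOn
      (fun s : ℝ => f (y + s • d) - s * ⟪g y, d⟫ + K / 2 * ‖d‖ ^ 2 * s ^ 2) (Set.Icc 0 1) := by
    refine monotoneOn_of_hasDerivWithinAt_nonneg (convex_Icc 0 1)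
      (fun t _ => (hderiv t).continuousAt.continuousWithinAt)
      (fun t _ => (hderiv t).hasDerivWithinAt) fun t ht => ?_
    rw [interior_Icc] at ht
    have hmem : y + t • d ∈ Y := hY.add_smul_sub_mem hy hz ⟨ht.1.le, ht.2.le⟩
    have h1 := hlip _ hmem y hy
    rw [add_sub_cancel_left, norm_smul, Real.norm_of_nonneg ht.1.le] at h1
    have h2 := neg_le_of_abs_le (abs_real_inner_le_norm (g (y + t • d) - g y) d)
    rw [inner_sub_left] at h2
    nlinarith [norm_nonneg d, mul_le_mul_of_nonneg_right h1 (norm_nonneg d)]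
  have h := hmono (Set.left_mem_Icc.2 zero_le_one) (Set.right_mem_Icc.2 zero_le_one) zero_le_one
  have hyz : y + d = z := by simp [hd]
  simp only [zero_smul, one_smul, add_zero, hyz] at h
  linarith

/-- First-order optimality of a maximizer over a convex set. -/
theorem IsMaxOn.inner_gradient_nonpos {f : F → ℝ} {v y : F} {Y : Set F} (hmax : IsMaxOn f Y y)
    (hv : HasGradientAt f v y) (hY : Convex ℝ Y) (hy : y ∈ Y) {z : F} (hz : z ∈ Y) :
    ⟪v, z - y⟫ ≤ 0 := by
  simpa using hmax.localize.hasFDerivWithinAt_nonpos hv.hasFDerivAt.hasFDerivWithinAt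
    (sub_mem_posTangentConeAt_of_segment_subset (hY.segment_subset hy hz))

end LinePath

section QuadraticTaylorBound

variable {F : Type*} [NormedAddCommGroup F] [InnerProductSpace ℝ F]
  {Y : Set F} {h : F → ℝ} {g : F → F} {ρ : ℝ}

theorem inner_sub_le_of_taylor_bound
    (hT : ∀ y ∈ Y, ∀ z ∈ Y, |h z - h y - ⟪g y, z - y⟫| ≤ ρ / 2 * ‖z - y‖ ^ 2)
    {a b w : F} (ha : a ∈ Y) (hb : b ∈ Y)
    (hp : (1 / 2 : ℝ) • (a + b) + (1 / 2 : ℝ) • w ∈ Y)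
    (hq : (1 / 2 : ℝ) • (a + b) - (1 / 2 : ℝ) • w ∈ Y) :
    ⟪g b - g a, w⟫ ≤ ρ / 2 * (‖b - a‖ ^ 2 + ‖w‖ ^ 2) := by
  set p := (1 / 2 : ℝ) • (a + b) + (1 / 2 : ℝ) • w with hpdef
  set q := (1 / 2 : ℝ) • (a + b) - (1 / 2 : ℝ) • w with hqdef
  have h1 := (abs_le.1 (hT a ha p hp)).2
  have h2 := (abs_le.1 (hT a ha q hq)).1
  have h3 := (abs_le.1 (hT b hb p hp)).1
  have h4 := (abs_le.1 (hT b hb q hq)).2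
  have e1 : p - a = (1 / 2 : ℝ) • ((b - a) + w) := by rw [hpdef]; module
  have e2 : q - a = (1 / 2 : ℝ) • ((b - a) - w) := by rw [hqdef]; module
  have e3 : p - b = (-1 / 2 : ℝ) • ((b - a) - w) := by rw [hpdef]; module
  have e4 : q - b = (-1 / 2 : ℝ) • ((b - a) + w) := by rw [hqdef]; module
  rw [e1] at h1
  rw [e2] at h2
  rw [e3] at h3
  rw [e4] at h4
  simp only [norm_smul, inner_smul_right, inner_add_right, inner_sub_right, mul_pow] at h1 h2 h3 h4
  norm_num at h1 h2 h3 h4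
  rw [inner_sub_left]
  have hpar := parallelogram_law_with_norm ℝ (b - a) w
  have hpar' := congrArg (fun x => ρ * x) hpar
  nlinarith

theorem inner_sub_le_of_taylor_bound_of_ball
    (hT : ∀ y ∈ Y, ∀ z ∈ Y, |h z - h y - ⟪g y, z - y⟫| ≤ ρ / 2 * ‖z - y‖ ^ 2)
    {V : Submodule ℝ F} {a b : F} (ha : a ∈ Y) (hb : b ∈ Y) {r : ℝ}
    (hball : ∀ v ∈ V, ‖v‖ ≤ r → (1 / 2 : ℝ) • (a + b) + v ∈ Y) (hab : ‖b - a‖ ≤ 2 * r)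
    {w : F} (hw : w ∈ V) :
    ⟪g b - g a, w⟫ ≤ ρ * ‖b - a‖ * ‖w‖ := by
  rcases eq_or_ne w 0 with rfl | hw0
  · simp
  rcases eq_or_ne b a with rfl | hba
  · simp
  have hwpos : 0 < ‖w‖ := norm_pos_iff.2 hw0
  have hdpos : 0 < ‖b - a‖ := norm_pos_iff.2 (sub_ne_zero.2 hba)
  set s := ‖b - a‖ / ‖w‖ with hs
  have hspos : 0 < s := div_pos hdpos hwpos
  have hsw : ‖s • w‖ = ‖b - a‖ := by
    rw [norm_smul, Real.norm_of_nonneg hspos.le, hs, div_mul_cancel₀ _ hwpos.ne']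
  have hhalf : ‖(1 / 2 : ℝ) • s • w‖ ≤ r := by
    rw [norm_smul, hsw]
    norm_num
    linarith
  have hmem : (1 / 2 : ℝ) • s • w ∈ V := V.smul_mem _ (V.smul_mem _ hw)
  have hp := hball _ hmem hhalf
  have hq := hball _ (V.neg_mem hmem) (by rwa [norm_neg])
  rw [← sub_eq_add_neg] at hq
  have hmain := inner_sub_le_of_taylor_bound hT ha hb hp hq
  rw [hsw, inner_smul_right] at hmain
  have hd : ‖b - a‖ = s * ‖w‖ := by rw [hs, div_mul_cancel₀ _ hwpos.ne']
  rw [hd] at hmain ⊢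
  refine le_of_mul_le_mul_left ?_ hspos
  linarith

theorem inner_sub_le_of_taylor_bound_of_thick_segment
    (hT : ∀ y ∈ Y, ∀ z ∈ Y, |h z - h y - ⟪g y, z - y⟫| ≤ ρ / 2 * ‖z - y‖ ^ 2)
    {V : Submodule ℝ F} {a b : F} {r : ℝ} (hr : 0 < r)
    (hball : ∀ t ∈ Set.Icc (0 : ℝ) 1, ∀ v ∈ V, ‖v‖ ≤ r → a + t • (b - a) + v ∈ Y)
    {w : F} (hw : w ∈ V) :
    ⟪g b - g a, w⟫ ≤ ρ * ‖b - a‖ * ‖w‖ := by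
  obtain ⟨N, hN⟩ := exists_nat_gt (‖b - a‖ / (2 * r))
  have hNpos : (0 : ℝ) < N := lt_of_le_of_lt (by positivity) hN
  set p : ℕ → F := fun i => a + ((i : ℝ) / N) • (b - a) with hp
  have hpmem : ∀ i ≤ N, p i ∈ Y := fun i hi => by
    have hi' : (i : ℝ) ≤ N := by exact_mod_cast hi
    simpa using hball (i / N) ⟨by positivity, (div_le_one hNpos).2 hi'⟩ 0 V.zero_mem
      (by simpa using hr.le)
  have hdiff : ∀ i, p (i + 1) - p i = (1 / N : ℝ) • (b - a) := fun i => by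
    simp only [hp]
    push_cast
    match_scalars <;> field_simp <;> ring
  have hnorm : ∀ i, ‖p (i + 1) - p i‖ = ‖b - a‖ / N := fun i => by
    rw [hdiff, norm_smul, Real.norm_of_nonneg (by positivity)]
    ring
  have hstep : ∀ i ∈ Finset.range N,
      ⟪g (p (i + 1)), w⟫ - ⟪g (p i), w⟫ ≤ ρ * (‖b - a‖ / N) * ‖w‖ := fun i hi => by
    rw [Finset.mem_range] at hi
    have hi' : (i : ℝ) + 1 ≤ N := by exact_mod_cast hi
    rw [← inner_sub_left, ← hnorm i]
    refine inner_sub_le_of_taylor_bound_of_ball hT (hpmem i hi.le) (hpmem (i + 1) hi) (r := r)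
      (fun v hv hvr => ?_) ?_ hw
    · have hmid : (1 / 2 : ℝ) • (p i + p (i + 1)) = a + (((i : ℝ) + 1 / 2) / N) • (b - a) := by
        simp only [hp]
        push_cast
        match_scalars <;> field_simp <;> ring
      rw [hmid]
      exact hball _ ⟨by positivity, (div_le_one hNpos).2 (by linarith)⟩ v hv hvr
    · rw [hnorm, div_le_iff₀ hNpos]
      rw [div_lt_iff₀ (by positivity)] at hN
      linarith
  have hsum := Finset.sum_le_sum hstep
  rw [Finset.sum_range_sub (fun i => ⟪g (p i), w⟫), Finset.sum_const, Finset.card_range,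
    nsmul_eq_mul] at hsum
  have hp0 : p 0 = a := by simp [hp]
  have hpN : p N = b := by simp [hp, div_self hNpos.ne']
  rw [hp0, hpN, ← inner_sub_left] at hsum
  refine hsum.trans_eq ?_
  field_simp

end QuadraticTaylorBound

theorem Convex.exists_ball_subset_vectorSpan {F : Type*} [NormedAddCommGroup F] [NormedSpace ℝ F]
    [FiniteDimensional ℝ F] {Y : Set F} (hY : Convex ℝ Y) (hne : Y.Nonempty) :
    ∃ c ∈ Y, ∃ r > 0, ∀ v ∈ vectorSpan ℝ Y, ‖v‖ ≤ r → c + v ∈ Y := by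
  obtain ⟨c, hc⟩ := hne.intrinsicInterior hY
  obtain ⟨c', hc', rfl⟩ := mem_intrinsicInterior.1 hc
  obtain ⟨r, hr, hball⟩ := Metric.mem_nhds_iff.1 (mem_interior_iff_mem_nhds.1 hc')
  refine ⟨c', intrinsicInterior_subset hc, r / 2, half_pos hr, fun v hv hvr => ?_⟩
  have hmem : (c' : F) + v ∈ affineSpan ℝ Y := by
    rw [add_comm]
    exact AffineSubspace.vadd_mem_of_mem_direction (by rwa [direction_affineSpan]) c'.2
  have hin : (⟨(c' : F) + v, hmem⟩ : affineSpan ℝ Y) ∈ Metric.ball c' r := by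
    rw [Metric.mem_ball, Subtype.dist_eq, dist_eq_norm, add_sub_cancel_left]
    linarith
  exact hball hin

/-- A two-sided quadratic Taylor bound on a convex set makes the gradient Lipschitz, with the same
constant, along the directions of the set. -/
theorem Convex.inner_sub_le_of_taylor_bound {F : Type*} [NormedAddCommGroup F]
    [InnerProductSpace ℝ F] [FiniteDimensional ℝ F] {Y : Set F} (hY : Convex ℝ Y)
    {h : F → ℝ} {g : F → F} {ρ : ℝ}
    (hT : ∀ y ∈ Y, ∀ z ∈ Y, |h z - h y - ⟪g y, z - y⟫| ≤ ρ / 2 * ‖z - y‖ ^ 2)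
    (hg : ContinuousOn g Y) {a b : F} (ha : a ∈ Y) (hb : b ∈ Y) {w : F}
    (hw : w ∈ vectorSpan ℝ Y) :
    ⟪g b - g a, w⟫ ≤ ρ * ‖b - a‖ * ‖w‖ := by
  obtain ⟨c, hc, r, hr, hball⟩ := hY.exists_ball_subset_vectorSpan ⟨a, ha⟩
  have hnear : ∀ᶠ t : ℝ in nhdsWithin 0 (Set.Ioi 0), t ∈ Set.Ioc (0 : ℝ) 1 :=
    Ioc_mem_nhdsGT one_pos
  have hlim : ∀ y ∈ Y, Filter.Tendsto (fun t : ℝ => y + t • (c - y))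
      (nhdsWithin 0 (Set.Ioi 0)) (nhdsWithin y Y) := fun y hy => by
    refine tendsto_nhdsWithin_iff.2 ⟨?_, ?_⟩
    · have hcont : Continuous (fun t : ℝ => y + t • (c - y)) := by fun_prop
      simpa using (hcont.tendsto 0).mono_left nhdsWithin_le_nhds
    · filter_upwards [hnear] with t ht
      exact hY.add_smul_sub_mem hy hc ⟨ht.1.le, ht.2⟩
  have hl := fun y hy => (hlim y hy).mono_right nhdsWithin_le_nhds
  have hgl := fun y hy => (hg y hy).tendsto.comp (hlim y hy)
  refine le_of_tendsto_of_tendsto (((hgl b hb).sub (hgl a ha)).inner tendsto_const_nhds)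
    ((((hl b hb).sub (hl a ha)).norm.const_mul ρ).mul_const ‖w‖) ?_
  filter_upwards [hnear] with t ht
  refine inner_sub_le_of_taylor_bound_of_thick_segment hT (mul_pos ht.1 hr)
    (V := vectorSpan ℝ Y) (fun s hs v hv hvr => ?_) hw
  have hvt : ‖t⁻¹ • v‖ ≤ r := by
    rw [norm_smul, norm_inv, Real.norm_of_nonneg ht.1.le, inv_mul_le_iff₀ ht.1]
    exact hvr
  have hmem := hY.add_smul_sub_mem (hY.add_smul_sub_mem ha hb hs)
    (hball _ (Submodule.smul_mem _ _ hv) hvt) ⟨ht.1.le, ht.2⟩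
  convert hmem using 1
  have hv' : v = t • t⁻¹ • v := by rw [smul_inv_smul₀ ht.1.ne']
  nth_rewrite 1 [hv']
  module

/-- A gradient ascent step for a strongly concave function, followed by the projection onto the
constraint set, is a contraction. -/
theorem projected_gradient_contraction {F : Type*} [NormedAddCommGroup F]
    [InnerProductSpace ℝ F] [FiniteDimensional ℝ F] {Y : Set F} (hY : Convex ℝ Y)
    {f : F → ℝ} {g : F → F} (hf : ConcaveOn ℝ Set.univ f) (hg : ∀ y, HasGradientAt f (g y) y)
    {K : ℝ} (hlip : ∀ y ∈ Y, ∀ y' ∈ Y, ‖g y - g y'‖ ≤ K * ‖y - y'‖)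
    {P : F → F} (hP : ∀ u : F, P u ∈ Y ∧ ∀ z ∈ Y, ⟪u - P u, z - P u⟫ ≤ 0)
    {μ σ : ℝ} (hσ0 : 0 ≤ σ) (hσ : σ * (K + 2 * μ) ≤ 2) (hσμ : σ * μ ≤ 1) (y₀ : F) {a b : F}
    (ha : a ∈ Y) (hb : b ∈ Y) :
    ‖P (a + σ • (g a - μ • (a - y₀))) - P (b + σ • (g b - μ • (b - y₀)))‖
      ≤ (1 - σ * μ) * ‖a - b‖ := by
  set T : F → F := fun y => (1 - σ * μ) • y + σ • g y with hTdef
  have htaylor : ∀ y ∈ Y, ∀ z ∈ Y,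
      |((1 - σ * μ) / 2 * ‖z‖ ^ 2 + σ * f z) - ((1 - σ * μ) / 2 * ‖y‖ ^ 2 + σ * f y)
        - ⟪T y, z - y⟫| ≤ (1 - σ * μ) / 2 * ‖z - y‖ ^ 2 := fun y hy z hz => by
    have hup := mul_le_mul_of_nonneg_left (hf.sub_le_inner_of_hasGradientAt (hg y) z) hσ0
    have hlow := mul_le_mul_of_nonneg_left
      (inner_sub_le_of_lipschitz_gradient hg hY hlip hy hz) hσ0
    have hsq : ‖z‖ ^ 2 = ‖y‖ ^ 2 + 2 * ⟪y, z - y⟫ + ‖z - y‖ ^ 2 := by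
      rw [← norm_add_sq_real, add_sub_cancel]
    simp only [hTdef]
    rw [inner_add_left, real_inner_smul_left, real_inner_smul_left, hsq, abs_le]
    have hstep := mul_le_mul_of_nonneg_right hσ (sq_nonneg ‖z - y‖)
    constructor <;> linarith
  have hcont : ContinuousOn g Y := by
    refine LipschitzOnWith.continuousOn (K := K.toNNReal) (LipschitzOnWith.of_dist_le_mul ?_)
    intro x hx y hy
    rw [dist_eq_norm, dist_eq_norm]
    exact (hlip x hx y hy).trans
      (mul_le_mul_of_nonneg_right (Real.le_coe_toNNReal K) (norm_nonneg _))
  have hTcont : ContinuousOn T Y := (continuousOn_id.const_smul _).add (hcont.const_smul _)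
  set u := a + σ • (g a - μ • (a - y₀)) with hu
  set v := b + σ • (g b - μ • (b - y₀)) with hv
  have huv : u - v = T a - T b := by
    simp only [hu, hv, hTdef]
    module
  have hmain := hY.inner_sub_le_of_taylor_bound htaylor hTcont hb ha
    (vsub_mem_vectorSpan ℝ (hP u).1 (hP v).1)
  rw [vsub_eq_sub, ← huv] at hmain
  have h1 := (hP u).2 _ (hP v).1
  have h2 := (hP v).2 _ (hP u).1
  have hnonexp : ‖P u - P v‖ * ‖P u - P v‖ ≤ ⟪u - v, P u - P v⟫ := by
    rw [← real_inner_self_eq_norm_mul_norm]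
    simp only [inner_sub_left, inner_sub_right] at h1 h2 ⊢
    linarith
  rcases (norm_nonneg (P u - P v)).eq_or_lt with h0 | hpos
  · rw [← h0]
    exact mul_nonneg (sub_nonneg.2 hσμ) (norm_nonneg _)
  · exact le_of_mul_le_mul_right (hnonexp.trans hmain) hpos

theorem projection_eq_of_inner_nonpos {F : Type*} [NormedAddCommGroup F] [InnerProductSpace ℝ F]
    {Y : Set F} {P : F → F} (hP : ∀ u : F, P u ∈ Y ∧ ∀ z ∈ Y, ⟪u - P u, z - P u⟫ ≤ 0)
    {u p : F} (hp : p ∈ Y) (h : ∀ z ∈ Y, ⟪u - p, z - p⟫ ≤ 0) : P u = p := by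
  have h1 := (hP u).2 p hp
  have h2 := h _ (hP u).1
  rw [← sub_eq_zero, ← real_inner_self_nonpos]
  simp only [inner_sub_left, inner_sub_right] at h1 h2 ⊢
  linarith

/-- Solutions of strongly monotone variational inequalities depend Lipschitz-continuously on the
operator. -/
theorem norm_sub_le_of_variational_inequality {F : Type*} [NormedAddCommGroup F]
    [InnerProductSpace ℝ F] {μ : ℝ} (hμ : 0 < μ) {G G' : F → F} {y₀ y y' : F} {δ : ℝ}
    (hmono : ⟪G y - G y', y - y'⟫ ≤ 0) (hdiff : ‖G y' - G' y'‖ ≤ δ)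
    (hy : ⟪G y - μ • (y - y₀), y' - y⟫ ≤ 0) (hy' : ⟪G' y' - μ • (y' - y₀), y - y'⟫ ≤ 0) :
    ‖y - y'‖ ≤ δ / μ := by
  have hcs := (real_inner_le_norm (G y' - G' y') (y - y')).trans
    (mul_le_mul_of_nonneg_right hdiff (norm_nonneg _))
  have hkey : μ * (‖y - y'‖ * ‖y - y'‖) ≤ δ * ‖y - y'‖ := by
    refine le_trans ?_ hcs
    rw [← real_inner_self_eq_norm_mul_norm]
    simp only [inner_sub_left, inner_sub_right, real_inner_smul_left] at *
    linarith
  rw [le_div_iff₀ hμ]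
  rcases (norm_nonneg (y - y')).eq_or_lt with h0 | hpos
  · rw [← h0, zero_mul]
    exact (norm_nonneg _).trans hdiff
  · refine le_of_mul_le_mul_right ?_ hpos
    linarith

theorem le_geometric_of_le_mul_add {e : ℕ → ℝ} {ρ δ : ℝ} (hρ0 : 0 ≤ ρ) (hρ1 : ρ < 1) (hδ : 0 ≤ δ)
    (h : ∀ k, e (k + 1) ≤ ρ * (e k + δ)) (k : ℕ) :
    e k ≤ ρ ^ k * e 0 + ρ / (1 - ρ) * δ := by
  have h1 : 0 < 1 - ρ := sub_pos.2 hρ1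
  induction k with
  | zero =>
    have : 0 ≤ ρ / (1 - ρ) * δ := by positivity
    simpa using this
  | succ k ih =>
    refine (h k).trans ((mul_le_mul_of_nonneg_left (add_le_add_left ih δ) hρ0).trans_eq ?_)
    field_simp
    ring

/-- along CG-RPGA-type iterates,
`‖y_{k+1} − y_k‖ ≤ 2ρ^k‖y₀ − y*_μ(x₀)‖ + (2L_yx ρ/(μ(1−ρ)))τD_X + (L_yx/μ)τD_X`. -/
theorem stmt_13 {E F : Type*}
    [NormedAddCommGroup E] [InnerProductSpace ℝ E] [FiniteDimensional ℝ E]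
    [NormedAddCommGroup F] [InnerProductSpace ℝ F] [FiniteDimensional ℝ F]
    (X : Set E) (Y : Set F)
    (hXne : X.Nonempty) (hXconv : Convex ℝ X) (hXcomp : IsCompact X)
    (hYne : Y.Nonempty) (hYconv : Convex ℝ Y) (hYcomp : IsCompact Y)
    (L : E → F → ℝ) (hLdiff : Differentiable ℝ (fun p : E × F => L p.1 p.2))
    (Lyy Lyx : ℝ) (hLyy : 0 ≤ Lyy) (hLyx : 0 < Lyx)
    (hlipy : ∀ x ∈ X, ∀ x' ∈ X, ∀ y ∈ Y, ∀ y' ∈ Y,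
      ‖gradY L x y - gradY L x' y'‖ ≤ Lyx * ‖x - x'‖ + Lyy * ‖y - y'‖)
    (hconc : ∀ x ∈ X, ConcaveOn ℝ Set.univ (L x))
    (P : F → F)
    (hP : ∀ u : F, P u ∈ Y ∧ ∀ z ∈ Y, ⟪u - P u, z - P u⟫ ≤ 0)
    (μ : ℝ) (hμ : 0 < μ)
    (τ : ℝ) (hτ : τ ∈ Set.Icc (0 : ℝ) 1)
    (σ : ℝ) (hσ0 : 0 < σ) (hσ : σ ≤ 2 / (Lyy + 2 * μ))
    (ρ : ℝ) (hρ : ρ = max |1 - σ * (Lyy + μ)| |1 - σ * μ|)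
    (xseq : ℕ → E) (yseq : ℕ → F)
    (hxseq : ∀ k : ℕ, xseq k ∈ X) (hy0 : yseq 0 ∈ Y)
    (ystar : E → F)
    (hystar : ∀ x ∈ X, ystar x ∈ Y ∧
      ∀ y ∈ Y, Lreg L μ (yseq 0) x y ≤ Lreg L μ (yseq 0) x (ystar x))
    (hxstep : ∀ k : ℕ, 1 ≤ k → ‖xseq k - xseq (k - 1)‖ ≤ τ * Metric.diam X)
    (hyrec : ∀ k : ℕ, 1 ≤ k → yseq k =
      P (yseq (k - 1) + σ • (gradY L (xseq k) (yseq (k - 1))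
        - μ • (yseq (k - 1) - yseq 0)))) :
    ∀ k : ℕ, ‖yseq (k + 1) - yseq k‖ ≤
      2 * ρ ^ k * ‖yseq 0 - ystar (xseq 0)‖
      + 2 * Lyx * ρ / (μ * (1 - ρ)) * τ * Metric.diam X
      + Lyx / μ * τ * Metric.diam X := by
  have hgrad : ∀ x y, HasGradientAt (L x) (gradY L x y) y := fun x y => by
    have hd : Differentiable ℝ (L x) :=
      hLdiff.comp ((differentiable_const x).prodMk differentiable_id)
    exact (hd y).hasGradientAt
  have hlipx : ∀ x ∈ X, ∀ y ∈ Y, ∀ y' ∈ Y,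
      ‖gradY L x y - gradY L x y'‖ ≤ Lyy * ‖y - y'‖ := fun x hx y hy y' hy' => by
    simpa using hlipy x hx x hx y hy y' hy'
  have hσ' : σ * (Lyy + 2 * μ) ≤ 2 := (le_div_iff₀ (by positivity)).1 hσ
  have hσμ : 0 < σ * μ := mul_pos hσ0 hμ
  have hσL : 0 ≤ σ * Lyy := mul_nonneg hσ0.le hLyy
  have hρ' : ρ = 1 - σ * μ := by
    have hnn : 0 ≤ 1 - σ * μ := by linarith
    rw [hρ, abs_of_nonneg hnn, max_eq_right (abs_le.2 ⟨by linarith, by linarith⟩)]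
  have hρ0 : 0 ≤ ρ := by linarith
  have hρ1 : ρ < 1 := by linarith
  set D := τ * Metric.diam X with hD
  have hD0 : 0 ≤ D := mul_nonneg hτ.1 Metric.diam_nonneg
  have hvi : ∀ x ∈ X, ∀ z ∈ Y,
      ⟪gradY L x (ystar x) - μ • (ystar x - yseq 0), z - ystar x⟫ ≤ 0 := fun x hx z hz => by
    have hgr : HasGradientAt (Lreg L μ (yseq 0) x)
        (gradY L x (ystar x) - μ • (ystar x - yseq 0)) (ystar x) := by
      have hsq := (((hasFDerivAt_id (𝕜 := ℝ) (ystar x)).sub_const (yseq 0)).norm_sq).const_mul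
        (μ / 2)
      rw [hasGradientAt_iff_hasFDerivAt]
      refine ((hgrad x (ystar x)).hasFDerivAt.sub hsq).congr_fderiv ?_
      ext v
      simp
      ring
    exact IsMaxOn.inner_gradient_nonpos (fun y hy => (hystar x hx).2 y hy) hgr hYconv
      (hystar x hx).1 hz
  have hfix : ∀ x ∈ X,
      P (ystar x + σ • (gradY L x (ystar x) - μ • (ystar x - yseq 0))) = ystar x := fun x hx =>
    projection_eq_of_inner_nonpos hP (hystar x hx).1 fun z hz => by
      rw [add_sub_cancel_left, real_inner_smul_left]
      exact mul_nonpos_of_nonneg_of_nonpos hσ0.le (hvi x hx z hz)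
  have hyseq : ∀ k, yseq k ∈ Y := fun k => by
    cases k with
    | zero => exact hy0
    | succ k => rw [hyrec (k + 1) (by omega)]; exact (hP _).1
  have hdrift : ∀ k, ‖ystar (xseq (k + 1)) - ystar (xseq k)‖ ≤ Lyx * D / μ := fun k => by
    have hx := hxseq (k + 1)
    have hx' := hxseq k
    refine norm_sub_le_of_variational_inequality hμ (G := gradY L (xseq (k + 1)))
      (G' := gradY L (xseq k)) ?_ ?_
      (hvi _ hx _ (hystar _ hx').1) (hvi _ hx' _ (hystar _ hx).1)
    · have h1 := (hconc _ hx).sub_le_inner_of_hasGradientAt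
        (hgrad _ (ystar (xseq (k + 1)))) (ystar (xseq k))
      have h2 := (hconc _ hx).sub_le_inner_of_hasGradientAt
        (hgrad _ (ystar (xseq k))) (ystar (xseq (k + 1)))
      simp only [inner_sub_left, inner_sub_right] at h1 h2 ⊢
      linarith
    · have h := hlipy _ hx _ hx' _ (hystar _ hx').1 _ (hystar _ hx').1
      rw [sub_self, norm_zero, mul_zero, add_zero] at h
      exact h.trans (mul_le_mul_of_nonneg_left (hxstep (k + 1) (by omega)) hLyx.le)
  have hcontr : ∀ k, ‖yseq (k + 1) - ystar (xseq (k + 1))‖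
      ≤ ρ * (‖yseq k - ystar (xseq k)‖ + Lyx * D / μ) := fun k => by
    have hx := hxseq (k + 1)
    have h := projected_gradient_contraction hYconv (hconc _ hx) (hgrad _) (hlipx _ hx) hP
      hσ0.le hσ' (by linarith) (yseq 0) (hyseq k) (hystar _ hx).1
    rw [hfix _ hx, ← hρ'] at h
    have hrec := hyrec (k + 1) (by omega)
    rw [Nat.add_sub_cancel] at hrec
    rw [← hrec] at h
    refine h.trans (mul_le_mul_of_nonneg_left ?_ hρ0)
    have htri := norm_sub_le_norm_sub_add_norm_sub (yseq k) (ystar (xseq k))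
      (ystar (xseq (k + 1)))
    rw [norm_sub_rev (ystar (xseq k))] at htri
    linarith [hdrift k]
  have hgeom := le_geometric_of_le_mul_add (e := fun k => ‖yseq k - ystar (xseq k)‖) hρ0 hρ1
    (by positivity) hcontr
  intro k
  have hk := hgeom k
  have hk1 := hgeom (k + 1)
  have ht1 := norm_sub_le_norm_sub_add_norm_sub (yseq (k + 1)) (ystar (xseq (k + 1))) (yseq k)
  have ht2 := norm_sub_le_norm_sub_add_norm_sub (ystar (xseq (k + 1))) (ystar (xseq k)) (yseq k)
  rw [norm_sub_rev (ystar (xseq k))] at ht2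
  have hpow : ρ ^ (k + 1) * ‖yseq 0 - ystar (xseq 0)‖ ≤ ρ ^ k * ‖yseq 0 - ystar (xseq 0)‖ :=
    mul_le_mul_of_nonneg_right (pow_le_pow_of_le_one hρ0 hρ1.le k.le_succ) (norm_nonneg _)
  have hsplit : 2 * Lyx * ρ / (μ * (1 - ρ)) * τ * Metric.diam X + Lyx / μ * τ * Metric.diam X
      = 2 * (ρ / (1 - ρ) * (Lyx * D / μ)) + Lyx * D / μ := by
    have h1 : 1 - ρ ≠ 0 := (sub_pos.2 hρ1).ne'
    rw [hD]
    field_simp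
  linarith [hdrift k]
end

section
/- Fix (x₀,y₀) ∈ X×Y. There exists a constant C > 0, depending only on 𝓛, X, Y, x₀, y₀, L_xx, L_yx and L_yy, such that for every integer K ≥ 2, the CG-RPGA iterates generated with parameters μ = K^{−1/4}, τ = K^{−3/4} and σ = 2/(L_yy + 2μ) admit an index t ∈ {⌈K/2⌉, …, K−1} with G_X(x_t,y_t) + G_Y^σ(x_t,y_t) ≤ C·K^{−1/4}. -/
open scoped RealInnerProductSpace

/-- Partial gradient of `L` in the first (primal) variable. -/
noncomputable def gradX {E F : Type*} [NormedAddCommGroup E] [InnerProductSpace ℝ E]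
    [CompleteSpace E] (L : E → F → ℝ) (x : E) (y : F) : E :=
  gradient (fun x' => L x' y) x

theorem exists_smul_sub_of_mem_vectorSpan {F : Type*} [AddCommGroup F] [Module ℝ F] {Y : Set F}
    (hY : Convex ℝ Y) (hne : Y.Nonempty) {v : F}
    (hv : v ∈ vectorSpan ℝ Y) :
    ∃ κ : ℝ, 0 ≤ κ ∧ ∃ a ∈ Y, ∃ b ∈ Y, v = κ • (a - b) := by
  obtain ⟨z, hz⟩ := hne
  induction hv using Submodule.span_induction with
  | mem v hv =>
    obtain ⟨a, ha, b, hb, rfl⟩ := hv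
    exact ⟨1, zero_le_one, a, ha, b, hb, by simp⟩
  | zero => exact ⟨0, le_rfl, z, hz, z, hz, by simp⟩
  | add v w _ _ hv hw =>
    obtain ⟨κ, hκ, a, ha, b, hb, rfl⟩ := hv
    obtain ⟨κ', hκ', a', ha', b', hb', rfl⟩ := hw
    rcases (add_nonneg hκ hκ').eq_or_lt with h | h
    · obtain rfl : κ = 0 := by linarith
      obtain rfl : κ' = 0 := by linarith
      exact ⟨0, le_rfl, z, hz, z, hz, by simp⟩
    · have hs : κ / (κ + κ') + κ' / (κ + κ') = 1 := by field_simp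
      refine ⟨κ + κ', h.le, _, hY ha ha' (by positivity) (by positivity) hs,
        _, hY hb hb' (by positivity) (by positivity) hs, ?_⟩
      match_scalars <;> field_simp
  | smul r v _ hv =>
    obtain ⟨κ, hκ, a, ha, b, hb, rfl⟩ := hv
    rcases le_total 0 r with hr | hr
    · exact ⟨r * κ, by positivity, a, ha, b, hb, by rw [smul_smul]⟩
    · refine ⟨-r * κ, mul_nonneg (by linarith) hκ, b, hb, a, ha, ?_⟩
      match_scalars <;> ring

section Gradient

variable {F : Type*} [NormedAddCommGroup F] [InnerProductSpace ℝ F] [CompleteSpace F]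
  {f : F → ℝ} {g : F → F} {Y : Set F} {ℓ : ℝ}

theorem HasGradientAt.hasDerivAt_add_smul {g' y v : F} {t : ℝ}
    (h : HasGradientAt f g' (y + t • v)) :
    HasDerivAt (fun s : ℝ => f (y + s • v)) ⟪g', v⟫ t := by
  have h1 : HasDerivAt (fun s : ℝ => y + s • v) v t := by
    simpa using ((hasDerivAt_id t).smul_const v).const_add y
  exact (h.hasFDerivAt.comp_hasDerivAt t h1).congr_deriv (by simp)

theorem ConvexOn.add_inner_gradient_le (hf : ConvexOn ℝ Set.univ f) {g' y : F}
    (hg : HasGradientAt f g' y) (z : F) : f y + ⟪g', z - y⟫ ≤ f z := by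
  have h1 : ConvexOn ℝ Set.univ (fun s : ℝ => f (y + s • (z - y))) := by
    have h2 := hf.comp_affineMap (AffineMap.lineMap (k := ℝ) y z)
    rw [Set.preimage_univ] at h2
    refine h2.congr fun s _ => ?_
    rw [Function.comp_apply, AffineMap.lineMap_apply_module', add_comm]
  have h2 : HasDerivAt (fun s : ℝ => f (y + s • (z - y))) ⟪g', z - y⟫ 0 :=
    HasGradientAt.hasDerivAt_add_smul (by simpa using hg)
  have h3 := h1.le_slope_of_hasDerivAt (Set.mem_univ 0) (Set.mem_univ 1) one_pos h2
  simp [slope_def_field] at h3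
  linarith

/-- The descent lemma, on a convex set on which the gradient is Lipschitz. -/
theorem le_add_inner_gradient_add_sq (hY : Convex ℝ Y) (hg : ∀ y, HasGradientAt f (g y) y)
    (hl : ∀ y ∈ Y, ∀ z ∈ Y, ‖g y - g z‖ ≤ ℓ * ‖y - z‖) {y z : F} (hy : y ∈ Y) (hz : z ∈ Y) :
    f z ≤ f y + ⟪g y, z - y⟫ + ℓ / 2 * ‖z - y‖ ^ 2 := by
  set v := z - y with hv
  have hd : ∀ t : ℝ, HasDerivAt (fun s : ℝ => f (y + s • v)) ⟪g (y + t • v), v⟫ t :=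
    fun t => (hg _).hasDerivAt_add_smul
  have hB : ∀ t : ℝ, HasDerivAt (fun s : ℝ => f y + s * ⟪g y, v⟫ + ℓ / 2 * s ^ 2 * ‖v‖ ^ 2)
      (⟪g y, v⟫ + ℓ * t * ‖v‖ ^ 2) t := by
    intro t
    have h := (((hasDerivAt_id t).mul_const ⟪g y, v⟫).const_add (f y)).add
      ((((hasDerivAt_id t).pow 2).const_mul (ℓ / 2)).mul_const (‖v‖ ^ 2))
    refine h.congr_deriv ?_
    simp only [id_eq, Nat.cast_ofNat]
    ring
  have key := image_le_of_deriv_right_le_deriv_boundary (a := 0) (b := 1)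
    (f := fun s : ℝ => f (y + s • v)) (f' := fun t => ⟪g (y + t • v), v⟫)
    (B := fun s : ℝ => f y + s * ⟪g y, v⟫ + ℓ / 2 * s ^ 2 * ‖v‖ ^ 2)
    (B' := fun t => ⟪g y, v⟫ + ℓ * t * ‖v‖ ^ 2)
    (fun t _ => (hd t).continuousAt.continuousWithinAt)
    (fun t _ => (hd t).hasDerivWithinAt) (by simp)
    (fun t _ => (hB t).continuousAt.continuousWithinAt)
    (fun t _ => (hB t).hasDerivWithinAt)
    (fun t ht => by
      have hm : y + t • v ∈ Y :=
        hY.add_smul_mem hy (by simpa [hv] using hz) ⟨ht.1, ht.2.le⟩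
      have h1 := real_inner_le_norm (g (y + t • v) - g y) v
      have h2 := hl _ hm _ hy
      rw [add_sub_cancel_left, norm_smul, Real.norm_of_nonneg ht.1] at h2
      rw [inner_sub_left] at h1
      nlinarith [mul_le_mul_of_nonneg_right h2 (norm_nonneg v)])
    (Set.right_mem_Icc.2 zero_le_one)
  simpa [hv] using key

/-- Cocoercivity in the direction `v` for two close points around which `Y` has room along `v`. -/
theorem sq_inner_gradient_sub_le_of_near (hY : Convex ℝ Y) (hf : ConvexOn ℝ Set.univ f)
    (hg : ∀ y, HasGradientAt f (g y) y) (hℓ : 0 < ℓ)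
    (hl : ∀ y ∈ Y, ∀ z ∈ Y, ‖g y - g z‖ ≤ ℓ * ‖y - z‖) {x y v : F} {η : ℝ} (hη : 0 < η)
    (hv : v ≠ 0) (hx : ∀ s : ℝ, |s| ≤ η → x + s • v ∈ Y) (hy : ∀ s : ℝ, |s| ≤ η → y + s • v ∈ Y)
    (hxy : ‖y - x‖ ≤ η * ‖v‖) :
    ⟪g y - g x, v⟫ ^ 2 ≤ ℓ * ⟪g y - g x, y - x⟫ * ‖v‖ ^ 2 := by
  have hv0 : 0 < ‖v‖ := norm_pos_iff.2 hv
  have half : ∀ x y : F, (∀ s : ℝ, |s| ≤ η → x + s • v ∈ Y) →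
      (∀ s : ℝ, |s| ≤ η → y + s • v ∈ Y) → ‖y - x‖ ≤ η * ‖v‖ →
      ⟪g y - g x, v⟫ ^ 2 / (2 * ℓ * ‖v‖ ^ 2) ≤ f y - f x - ⟪g x, y - x⟫ := by
    intro x y hx hy hxy
    have hxY : x ∈ Y := by simpa using hx 0 (by simpa using hη.le)
    have hyY : y ∈ Y := by simpa using hy 0 (by simpa using hη.le)
    set c := ⟪g y - g x, v⟫ with hc
    set s : ℝ := -c / (ℓ * ‖v‖ ^ 2) with hs
    have hsη : |s| ≤ η := by
      rw [hs, abs_div, abs_neg, abs_of_pos (by positivity : 0 < ℓ * ‖v‖ ^ 2), div_le_iff₀ (by positivity)]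
      have h1 := abs_real_inner_le_norm (g y - g x) v
      have h2 := hl y hyY x hxY
      calc |c| ≤ ‖g y - g x‖ * ‖v‖ := h1
        _ ≤ (ℓ * (η * ‖v‖)) * ‖v‖ := by gcongr; exact h2.trans (by gcongr)
        _ = _ := by ring
    have h1 := le_add_inner_gradient_add_sq hY hg hl hyY (hy s hsη)
    have h2 := hf.add_inner_gradient_le (hg x) (y + s • v)
    rw [add_sub_cancel_left, inner_smul_right, norm_smul, mul_pow, Real.norm_eq_abs, sq_abs] at h1
    rw [add_sub_right_comm, inner_add_right, inner_smul_right] at h2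
    have h3 : s * c + ℓ / 2 * (s ^ 2 * ‖v‖ ^ 2) = - (c ^ 2 / (2 * ℓ * ‖v‖ ^ 2)) := by
      rw [hs]; field_simp; ring
    have h4 : c = ⟪g y, v⟫ - ⟪g x, v⟫ := by rw [hc, inner_sub_left]
    have h5 : s * c = s * ⟪g y, v⟫ - s * ⟪g x, v⟫ := by rw [h4]; ring
    linarith
  have h1 := half x y hx hy hxy
  have h2 := half y x hy hx (by rwa [norm_sub_rev])
  have h3 : ⟪g x - g y, v⟫ ^ 2 = ⟪g y - g x, v⟫ ^ 2 := by
    rw [← neg_sub (g y), inner_neg_left, neg_sq]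
  rw [h3] at h2
  have h4 : ⟪g y, x - y⟫ = - ⟪g y, y - x⟫ := by rw [← neg_sub y x, inner_neg_right]
  rw [h4] at h2
  have h5 : ⟪g y - g x, v⟫ ^ 2 / (ℓ * ‖v‖ ^ 2) ≤ ⟪g y - g x, y - x⟫ := by
    rw [inner_sub_left (g y) (g x) (y - x)]
    calc _ = ⟪g y - g x, v⟫ ^ 2 / (2 * ℓ * ‖v‖ ^ 2) + ⟪g y - g x, v⟫ ^ 2 / (2 * ℓ * ‖v‖ ^ 2) := by
          field_simp; ring
      _ ≤ _ := by linarith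
  rw [div_le_iff₀ (by positivity)] at h5
  linarith

theorem sq_inner_gradient_sub_le_of_segment (hY : Convex ℝ Y) (hf : ConvexOn ℝ Set.univ f)
    (hg : ∀ y, HasGradientAt f (g y) y) (hℓ : 0 < ℓ)
    (hl : ∀ y ∈ Y, ∀ z ∈ Y, ‖g y - g z‖ ≤ ℓ * ‖y - z‖) {x y v : F} {η : ℝ} (hη : 0 < η)
    (hv : v ≠ 0)
    (hxy : ∀ r ∈ Set.Icc (0 : ℝ) 1, ∀ s : ℝ, |s| ≤ η → x + r • (y - x) + s • v ∈ Y) :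
    ⟪g y - g x, v⟫ ^ 2 ≤ ℓ * ⟪g y - g x, y - x⟫ * ‖v‖ ^ 2 := by
  have hv0 : 0 < ‖v‖ := norm_pos_iff.2 hv
  obtain ⟨n, hn⟩ := exists_nat_gt (‖y - x‖ / (η * ‖v‖))
  have hn0 : (0 : ℝ) < n := lt_of_le_of_lt (by positivity) hn
  set p : ℕ → F := fun i => x + ((i : ℝ) / n) • (y - x) with hp
  have hstep : ∀ i, p (i + 1) - p i = (1 / (n : ℝ)) • (y - x) := by
    intro i
    simp only [hp, add_sub_add_left_eq_sub, ← sub_smul]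
    congr 1
    push_cast
    ring
  have hmem : ∀ i ≤ n, ∀ s : ℝ, |s| ≤ η → p i + s • v ∈ Y := fun i hi s hs =>
    hxy _ ⟨by positivity, by rw [div_le_one hn0]; exact_mod_cast hi⟩ s hs
  have hloc : ∀ i ∈ Finset.range n, ⟪g (p (i + 1)) - g (p i), v⟫ ^ 2 ≤
      ℓ * ‖v‖ ^ 2 / n * ⟪g (p (i + 1)) - g (p i), y - x⟫ := by
    intro i hi
    have hi' := Finset.mem_range.1 hi
    have h := sq_inner_gradient_sub_le_of_near hY hf hg hℓ hl hη hv (hmem i hi'.le)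
      (hmem (i + 1) hi') (by
        rw [hstep, norm_smul, Real.norm_of_nonneg (by positivity)]
        rw [div_lt_iff₀ (by positivity)] at hn
        rw [one_div, inv_mul_le_iff₀ hn0]
        exact hn.le)
    rw [hstep, inner_smul_right] at h
    calc _ ≤ _ := h
      _ = _ := by ring
  have htel : ∀ w : F, ∑ i ∈ Finset.range n, ⟪g (p (i + 1)) - g (p i), w⟫ = ⟪g y - g x, w⟫ := by
    intro w
    rw [← sum_inner, Finset.sum_range_sub (fun i => g (p i))]
    simp [hp, hn0.ne']
  calc ⟪g y - g x, v⟫ ^ 2 = (∑ i ∈ Finset.range n, ⟪g (p (i + 1)) - g (p i), v⟫) ^ 2 := by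
        rw [htel]
    _ ≤ n * ∑ i ∈ Finset.range n, ⟪g (p (i + 1)) - g (p i), v⟫ ^ 2 := by
        simpa using sq_sum_le_card_mul_sum_sq (s := Finset.range n)
          (f := fun i => ⟪g (p (i + 1)) - g (p i), v⟫)
    _ ≤ n * ∑ i ∈ Finset.range n, ℓ * ‖v‖ ^ 2 / n * ⟪g (p (i + 1)) - g (p i), y - x⟫ := by
        gcongr with i hi
        exact hloc i hi
    _ = _ := by
        rw [← Finset.mul_sum, htel]
        field_simp

theorem sq_inner_gradient_sub_le (hY : Convex ℝ Y) (hf : ConvexOn ℝ Set.univ f)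
    (hg : ∀ y, HasGradientAt f (g y) y) (hℓ : 0 ≤ ℓ)
    (hl : ∀ y ∈ Y, ∀ z ∈ Y, ‖g y - g z‖ ≤ ℓ * ‖y - z‖) {x y a b : F}
    (hx : x ∈ Y) (hy : y ∈ Y) (ha : a ∈ Y) (hb : b ∈ Y) :
    ⟪g y - g x, a - b⟫ ^ 2 ≤ ℓ * ⟪g y - g x, y - x⟫ * ‖a - b‖ ^ 2 := by
  rcases hℓ.eq_or_lt with rfl | hℓ
  · have h := hl y hy x hx
    rw [zero_mul, norm_le_zero_iff] at h
    simp [h]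
  by_cases hv : a - b = 0
  · simp [hv]
  set m : F := (1 / 2 : ℝ) • a + (1 / 2 : ℝ) • b with hm
  set c : F → ℝ → F := fun z t => (1 - t) • z + t • m with hc
  have hmY : m ∈ Y := hY ha hb (by norm_num) (by norm_num) (by norm_num)
  have hcY : ∀ z ∈ Y, ∀ t ∈ Set.Icc (0 : ℝ) 1, c z t ∈ Y := fun z hz t ht =>
    hY hz hmY (by linarith [ht.2]) ht.1 (by ring)
  have hcont : ContinuousOn g Y := by
    refine (LipschitzOnWith.of_dist_le_mul (K := ⟨ℓ, hℓ.le⟩) fun y hy z hz => ?_).continuousOn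
    rw [dist_eq_norm, dist_eq_norm]
    exact hl y hy z hz
  have hcc : ∀ z, Filter.Tendsto (c z) (nhdsWithin 0 (Set.Ioc 0 1)) (nhds z) := by
    intro z
    have h : Continuous (c z) := by fun_prop
    simpa [hc] using (h.tendsto 0).mono_left (nhdsWithin_le_nhds (s := Set.Ioc (0 : ℝ) 1))
  have hgc : ∀ z ∈ Y, Filter.Tendsto (fun t => g (c z t)) (nhdsWithin 0 (Set.Ioc 0 1))
      (nhds (g z)) := fun z hz =>
    (hcont z hz).tendsto.comp (tendsto_nhdsWithin_iff.2 ⟨hcc z, by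
      filter_upwards [self_mem_nhdsWithin] with t ht
      exact hcY z hz t ⟨ht.1.le, ht.2⟩⟩)
  have : (nhdsWithin (0 : ℝ) (Set.Ioc 0 1)).NeBot := by
    rw [nhdsWithin_Ioc_eq_nhdsGT one_pos]
    infer_instance
  have hgd := (hgc y hy).sub (hgc x hx)
  refine le_of_tendsto_of_tendsto ((hgd.inner tendsto_const_nhds).pow 2)
    (((hgd.inner ((hcc y).sub (hcc x))).const_mul ℓ).mul_const (‖a - b‖ ^ 2)) ?_
  filter_upwards [self_mem_nhdsWithin] with t ht
  refine sq_inner_gradient_sub_le_of_segment hY hf hg hℓ hl (η := t / 2) (by linarith [ht.1]) hv ?_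
  intro r hr s hs
  have ht0 : t ≠ 0 := ht.1.ne'
  have hst : |s / t| ≤ 1 / 2 := by
    rw [abs_div, abs_of_pos ht.1, div_le_iff₀ ht.1]
    linarith
  rw [abs_le] at hst
  have h1 : (1 / 2 + s / t) • a + (1 / 2 - s / t) • b ∈ Y :=
    hY ha hb (by linarith) (by linarith) (by ring)
  have h2 : (1 - r) • x + r • y ∈ Y := hY hx hy (by linarith [hr.2]) hr.1 (by ring)
  have h3 := hY h2 h1 (sub_nonneg.2 ht.2) ht.1.le (by ring)
  convert h3 using 1
  simp only [hc, hm]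
  match_scalars <;> field_simp <;> ring

/-- Cocoercivity of the gradient relative to a convex set: only the component tangent to the set is
controlled. -/
theorem sq_norm_starProjection_gradient_sub_le [FiniteDimensional ℝ F]
    (hY : Convex ℝ Y) (hf : ConvexOn ℝ Set.univ f)
    (hg : ∀ y, HasGradientAt f (g y) y) (hℓ : 0 ≤ ℓ)
    (hl : ∀ y ∈ Y, ∀ z ∈ Y, ‖g y - g z‖ ≤ ℓ * ‖y - z‖) {x y : F} (hx : x ∈ Y) (hy : y ∈ Y) :
    ‖(vectorSpan ℝ Y).starProjection (g y - g x)‖ ^ 2 ≤ ℓ * ⟪g y - g x, y - x⟫ := by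
  set V := vectorSpan ℝ Y
  set e := g y - g x with he
  set e' := V.starProjection e with he'
  have hmem : e' ∈ V := V.starProjection_apply_mem e
  obtain ⟨κ, hκ, a, ha, b, hb, hab⟩ := exists_smul_sub_of_mem_vectorSpan hY ⟨x, hx⟩ hmem
  have h := sq_inner_gradient_sub_le hY hf hg hℓ hl hx hy ha hb
  have h1 : ⟪e, e'⟫ = ‖e'‖ ^ 2 := by
    rw [← real_inner_self_eq_norm_sq]
    conv_rhs => rw [he', V.inner_starProjection_left_eq_right,
      Submodule.starProjection_eq_self_iff.2 (V.starProjection_apply_mem e)]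
  have h2 : ⟪e, e'⟫ ^ 2 ≤ ℓ * ⟪e, y - x⟫ * ‖e'‖ ^ 2 := by
    rw [hab, inner_smul_right, norm_smul, mul_pow, mul_pow, Real.norm_eq_abs, sq_abs]
    nlinarith [mul_le_mul_of_nonneg_left h (sq_nonneg κ)]
  rw [h1] at h2
  have hnn : 0 ≤ ⟪e, y - x⟫ := by
    have h3 := hf.add_inner_gradient_le (hg x) y
    have h4 := hf.add_inner_gradient_le (hg y) x
    rw [← neg_sub y x, inner_neg_right] at h4
    rw [he, inner_sub_left]
    linarith
  by_cases h0 : ‖e'‖ = 0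
  · rw [h0]; simpa using mul_nonneg hℓ hnn
  · have : 0 < ‖e'‖ ^ 2 := by positivity
    nlinarith

/-- A projected gradient step with step size `2 / (ℓ + 2 μ)` on the objective
`f + μ / 2 * ‖· - y₀‖ ^ 2` contracts distances by the factor `ℓ / (ℓ + 2 μ)`. -/
theorem norm_sub_le_of_projected_gradient_step [FiniteDimensional ℝ F]
    (hY : Convex ℝ Y) (hf : ConvexOn ℝ Set.univ f)
    (hg : ∀ y, HasGradientAt f (g y) y) (hℓ : 0 ≤ ℓ)
    (hl : ∀ y ∈ Y, ∀ z ∈ Y, ‖g y - g z‖ ≤ ℓ * ‖y - z‖) {μ : ℝ} (hμ : 0 < μ) (y₀ : F)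
    {y a b : F} (hy : y ∈ Y) (ha : a ∈ Y) (hb : b ∈ Y)
    (hay : ⟪y + (2 / (ℓ + 2 * μ)) • (-g y - μ • (y - y₀)) - a, b - a⟫ ≤ 0)
    (hbb : ⟪-g b - μ • (b - y₀), a - b⟫ ≤ 0) :
    ‖a - b‖ ≤ ℓ / (ℓ + 2 * μ) * ‖y - b‖ := by
  have hc := sq_norm_starProjection_gradient_sub_le hY hf hg hℓ hl hb hy
  set V := vectorSpan ℝ Y
  set e := g y - g b with he
  set e' := V.starProjection e with he'
  set q := ℓ / (ℓ + 2 * μ) with hq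
  set σ := 2 / (ℓ + 2 * μ) with hσ
  have hden : 0 < ℓ + 2 * μ := by positivity
  have hσ0 : 0 < σ := by positivity
  have hq0 : 0 ≤ q := by positivity
  have hqσ : 2 * q = σ * ℓ := by rw [hq, hσ]; ring
  have hqμ : q = 1 - σ * μ := by rw [hq, hσ]; field_simp; ring
  have hinner : ∀ w ∈ V, ⟪e', w⟫ = ⟪e, w⟫ := by
    intro w hw
    rw [he', V.inner_starProjection_left_eq_right, Submodule.starProjection_eq_self_iff.2 hw]
  have hd : y - b ∈ V := vsub_mem_vectorSpan ℝ hy hb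
  have hw : a - b ∈ V := vsub_mem_vectorSpan ℝ ha hb
  set z := q • (y - b) - σ • e' with hz
  have hznorm : ‖z‖ ≤ q * ‖y - b‖ := by
    refine le_of_sq_le_sq ?_ (by positivity)
    rw [hz, norm_sub_sq_real, norm_smul, norm_smul, inner_smul_left, inner_smul_right,
      real_inner_comm, hinner _ hd, Real.norm_of_nonneg hq0, Real.norm_of_nonneg hσ0.le]
    simp only [conj_trivial]
    have := mul_le_mul_of_nonneg_left hc (sq_nonneg σ)
    have h2 : 2 * (q * (σ * ⟪e, y - b⟫)) = σ ^ 2 * (ℓ * ⟪e, y - b⟫) := by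
      linear_combination (σ * ⟪e, y - b⟫) * hqσ
    rw [h2]
    nlinarith
  have hle : ‖a - b‖ ^ 2 ≤ ⟪z, a - b⟫ := by
    have hzw : ⟪z, a - b⟫ = ⟪q • (y - b) - σ • e, a - b⟫ := by
      rw [hz, inner_sub_left, inner_sub_left, inner_smul_left, inner_smul_left, inner_smul_left,
        hinner _ hw]
    have hid : q • (y - b) - σ • e = (y + σ • (-g y - μ • (y - y₀)) - a) + (a - b)
        - σ • (-g b - μ • (b - y₀)) := by
      rw [he, hqμ]
      module
    rw [hzw, hid, inner_sub_left, inner_add_left, real_inner_self_eq_norm_sq, inner_smul_left]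
    rw [← neg_sub a b, inner_neg_right] at hay
    simp only [conj_trivial]
    nlinarith
  have hCS := real_inner_le_norm z (a - b)
  by_cases h0 : ‖a - b‖ = 0
  · rw [h0]; positivity
  · have : 0 < ‖a - b‖ := lt_of_le_of_ne (norm_nonneg _) (Ne.symm h0)
    refine le_trans ?_ hznorm
    nlinarith

end Gradient

theorem inner_le_zero_of_isMaxOn_regularized {F : Type*} [NormedAddCommGroup F]
    [InnerProductSpace ℝ F] [CompleteSpace F] {f : F → ℝ} {Y : Set F} (hY : Convex ℝ Y)
    {μ : ℝ} {y₀ b g' z : F} (hg : HasGradientAt f g' b)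
    (hmax : IsMaxOn (fun y => f y - μ / 2 * ‖y - y₀‖ ^ 2) Y b) (hb : b ∈ Y) (hz : z ∈ Y) :
    ⟪g' - μ • (b - y₀), z - b⟫ ≤ 0 := by
  have h1 := hg.hasFDerivAt.sub
    ((((hasFDerivAt_id b).sub_const y₀).norm_sq).const_mul (μ / 2))
  have h2 := hmax.localize.hasFDerivWithinAt_nonpos h1.hasFDerivWithinAt
    (sub_mem_posTangentConeAt_of_segment_subset (hY.segment_subset hb hz))
  simp at h2
  rw [inner_sub_left, inner_smul_left]
  simp only [conj_trivial]
  rw [inner_sub_left b y₀]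
  linarith

/-- Solutions of two variational inequalities for `μ`-regularized monotone operators differ by at
most `1 / μ` times the difference of the operators. -/
theorem norm_sub_le_of_variational_inequality_s16 {F : Type*} [NormedAddCommGroup F]
    [InnerProductSpace ℝ F] {μ m : ℝ} {y₀ b₁ b₂ : F} {G₁ G₂ : F → F}
    (h₁ : ⟪G₁ b₁ - μ • (b₁ - y₀), b₂ - b₁⟫ ≤ 0)
    (h₂ : ⟪G₂ b₂ - μ • (b₂ - y₀), b₁ - b₂⟫ ≤ 0) (hmono : 0 ≤ ⟪G₁ b₁ - G₁ b₂, b₂ - b₁⟫)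
    (hm : ‖G₁ b₂ - G₂ b₂‖ ≤ m) : μ * ‖b₁ - b₂‖ ≤ m := by
  have hCS := real_inner_le_norm (G₁ b₂ - G₂ b₂) (b₁ - b₂)
  have key : μ * ‖b₁ - b₂‖ ^ 2 ≤ ⟪G₁ b₂ - G₂ b₂, b₁ - b₂⟫ := by
    have hid : ⟪G₁ b₁ - μ • (b₁ - y₀), b₂ - b₁⟫ + ⟪G₂ b₂ - μ • (b₂ - y₀), b₁ - b₂⟫
        = ⟪G₁ b₁ - G₁ b₂, b₂ - b₁⟫ - ⟪G₁ b₂ - G₂ b₂, b₁ - b₂⟫ + μ * ‖b₁ - b₂‖ ^ 2 := by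
      rw [← real_inner_self_eq_norm_sq, ← neg_sub b₁ b₂]
      simp only [inner_sub_left, inner_smul_left, inner_neg_right, conj_trivial]
      ring
    linarith
  by_cases h0 : ‖b₁ - b₂‖ = 0
  · rw [h0, mul_zero]; exact (norm_nonneg _).trans hm
  · have : 0 < ‖b₁ - b₂‖ := lt_of_le_of_ne (norm_nonneg _) (Ne.symm h0)
    nlinarith [mul_le_mul_of_nonneg_right hm this.le]

theorem norm_sub_le_of_isProjection {F : Type*} [NormedAddCommGroup F]
    [InnerProductSpace ℝ F] {Y : Set F} {P : F → F}
    (hP : ∀ u : F, P u ∈ Y ∧ ∀ z ∈ Y, ⟪u - P u, z - P u⟫ ≤ 0) (u w : F) :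
    ‖P u - P w‖ ≤ ‖u - w‖ := by
  have h1 := (hP u).2 _ (hP w).1
  have h2 := (hP w).2 _ (hP u).1
  have hCS := real_inner_le_norm (u - w) (P u - P w)
  have hid : ⟪u - P u, P w - P u⟫ + ⟪w - P w, P u - P w⟫
      = ‖P u - P w‖ ^ 2 - ⟪u - w, P u - P w⟫ := by
    rw [← real_inner_self_eq_norm_sq, ← neg_sub (P u) (P w)]
    simp only [inner_sub_left, inner_neg_right]
    ring
  by_cases h0 : ‖P u - P w‖ = 0
  · rw [h0]; exact norm_nonneg _
  · have : 0 < ‖P u - P w‖ := lt_of_le_of_ne (norm_nonneg _) (Ne.symm h0)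
    nlinarith

/-- A potential argument: if the decrease of `V` controls `gap`, then `gap` is small at some index
in the second half of the run. -/
theorem exists_gap_le_of_potential {V gap : ℕ → ℝ} {ε C W : ℝ} {K : ℕ} (hK : 2 ≤ K) (hε : 0 < ε)
    (hKε : K * ε ^ 4 = 1)
    (hstep : ∀ k < K, ε ^ 3 * gap k ≤ V k - V (k + 1) + ε ^ 4 * C)
    (hW : ∀ k ≤ K, V k - V K ≤ W) :
    ∃ t, (K + 1) / 2 ≤ t ∧ t ≤ K - 1 ∧ gap t ≤ (C + 3 * W + 1) * ε := by
  by_contra! hcon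
  have hW0 : 0 ≤ W := by simpa using hW K le_rfl
  set h := (K + 1) / 2 with hh
  have hind : ∀ n, h ≤ n → n ≤ K → V n ≤ V h - ((n : ℝ) - h) * (ε ^ 4 * (3 * W + 1)) := by
    intro n hn
    induction n, hn using Nat.le_induction with
    | base => simp
    | succ n hn ih =>
      intro hnK
      have h1 := ih (by omega)
      have h2 := hstep n (by omega)
      have h3 := mul_lt_mul_of_pos_left (hcon n hn (by omega)) (pow_pos hε 3)
      push_cast
      linarith
  have h1 := hind K (by omega) le_rfl
  have h2 := hW h (by omega)
  have h3 : (K : ℝ) ≤ 3 * (K - h) := by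
    have : 3 * h ≤ 2 * K := by omega
    have : 3 * (h : ℝ) ≤ 2 * K := by exact_mod_cast this
    linarith
  have h4 : 1 ≤ 3 * (((K : ℝ) - h) * ε ^ 4) := by
    rw [← hKε]
    nlinarith [pow_pos hε 4]
  nlinarith

/-- Corollary 2: with `μ = K^{-1/4}`, `τ = K^{-3/4}` and
`σ = 2/(L_yy + 2μ)`, the CG-RPGA iterates admit an index `t ∈ {⌈K/2⌉,…,K−1}` with
`G_X(x_t,y_t) + G_Y^σ(x_t,y_t) ≤ C·K^{-1/4}` for a constant `C` depending only on the data. -/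
theorem stmt_16 {E F : Type*}
    [NormedAddCommGroup E] [InnerProductSpace ℝ E] [FiniteDimensional ℝ E]
    [NormedAddCommGroup F] [InnerProductSpace ℝ F] [FiniteDimensional ℝ F]
    (X : Set E) (Y : Set F)
    (hXne : X.Nonempty) (hXconv : Convex ℝ X) (hXcomp : IsCompact X)
    (hYne : Y.Nonempty) (hYconv : Convex ℝ Y) (hYcomp : IsCompact Y)
    (L : E → F → ℝ) (hLdiff : Differentiable ℝ (fun p : E × F => L p.1 p.2))
    (Lxx Lyy Lyx : ℝ) (hLxx : 0 ≤ Lxx) (hLyy : 0 ≤ Lyy) (hLyx : 0 < Lyx)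
    (hlipx : ∀ x ∈ X, ∀ x' ∈ X, ∀ y ∈ Y, ∀ y' ∈ Y,
      ‖gradX L x y - gradX L x' y'‖ ≤ Lxx * ‖x - x'‖ + Lyx * ‖y - y'‖)
    (hlipy : ∀ x ∈ X, ∀ x' ∈ X, ∀ y ∈ Y, ∀ y' ∈ Y,
      ‖gradY L x y - gradY L x' y'‖ ≤ Lyx * ‖x - x'‖ + Lyy * ‖y - y'‖)
    (hconc : ∀ x ∈ X, ConcaveOn ℝ Set.univ (L x))
    (P : F → F)
    (hP : ∀ u : F, P u ∈ Y ∧ ∀ z ∈ Y, ⟪u - P u, z - P u⟫ ≤ 0)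
    (x₀ : E) (y₀ : F) (hx₀ : x₀ ∈ X) (hy₀ : y₀ ∈ Y) :
    ∃ C : ℝ, 0 < C ∧ ∀ K : ℕ, 2 ≤ K →
      ∀ (xseq : ℕ → E) (yseq : ℕ → F) (s : ℕ → E),
        xseq 0 = x₀ → yseq 0 = y₀ →
        (∀ k < K, s k ∈ X ∧ ∀ x ∈ X,
          ⟪gradX L (xseq k) (yseq k), s k⟫ ≤ ⟪gradX L (xseq k) (yseq k), x⟫) →
        (∀ k < K, xseq (k + 1) =
          ((K : ℝ) ^ (-(3 : ℝ) / 4)) • s k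
          + (1 - (K : ℝ) ^ (-(3 : ℝ) / 4)) • xseq k) →
        (∀ k < K, yseq (k + 1) =
          P (yseq k + (2 / (Lyy + 2 * (K : ℝ) ^ (-(1 : ℝ) / 4))) •
            (gradY L (xseq k) (yseq k)
              - ((K : ℝ) ^ (-(1 : ℝ) / 4)) • (yseq k - y₀)))) →
        ∃ t : ℕ, (K + 1) / 2 ≤ t ∧ t ≤ K - 1 ∧
          sSup ((fun x' => ⟪gradX L (xseq t) (yseq t), xseq t - x'⟫) '' X)
          + 1 / (2 / (Lyy + 2 * (K : ℝ) ^ (-(1 : ℝ) / 4))) *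
            ‖yseq t - P (yseq t + (2 / (Lyy + 2 * (K : ℝ) ^ (-(1 : ℝ) / 4))) •
              gradY L (xseq t) (yseq t))‖
          ≤ C * (K : ℝ) ^ (-(1 : ℝ) / 4) := by

  have hgX : ∀ y x, HasGradientAt (fun x' => L x' y) (gradX L x y) x := fun y x =>
    DifferentiableAt.hasGradientAt
      ((hLdiff (x, y)).comp (f := fun x' => (x', y)) x (by fun_prop))
  have hgY : ∀ x y, HasGradientAt (fun y' => L x y') (gradY L x y) y := fun x y =>
    DifferentiableAt.hasGradientAt
      ((hLdiff (x, y)).comp (f := fun y' => (x, y')) y (by fun_prop))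
  have hgY' : ∀ x y, HasGradientAt (fun y' => -L x y') (-gradY L x y) y := fun x y => by
    rw [hasGradientAt_iff_hasFDerivAt, map_neg]
    exact (hgY x y).hasFDerivAt.neg
  have hconv : ∀ x ∈ X, ConvexOn ℝ Set.univ (fun y => -L x y) := fun x hx => (hconc x hx).neg
  have hlX : ∀ y ∈ Y, ∀ x ∈ X, ∀ x' ∈ X, ‖gradX L x y - gradX L x' y‖ ≤ Lxx * ‖x - x'‖ :=
    fun y hy x hx x' hx' => by simpa using hlipx x hx x' hx' y hy y hy
  have hlY : ∀ x ∈ X, ∀ y ∈ Y, ∀ y' ∈ Y, ‖-gradY L x y - -gradY L x y'‖ ≤ Lyy * ‖y - y'‖ :=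
    fun x hx y hy y' hy' => by
      rw [← neg_sub', norm_neg]
      simpa using hlipy x hx x hx y hy y' hy'
  obtain ⟨DX, hDX0, hDX⟩ : ∃ D : ℝ, 0 ≤ D ∧ ∀ x ∈ X, ∀ x' ∈ X, ‖x - x'‖ ≤ D :=
    ⟨Metric.diam X, Metric.diam_nonneg, fun x hx x' hx' => by
      rw [← dist_eq_norm]; exact Metric.dist_le_diam_of_mem hXcomp.isBounded hx hx'⟩
  obtain ⟨DY, hDY0, hDY⟩ : ∃ D : ℝ, 0 ≤ D ∧ ∀ y ∈ Y, ∀ y' ∈ Y, ‖y - y'‖ ≤ D :=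
    ⟨Metric.diam Y, Metric.diam_nonneg, fun y hy y' hy' => by
      rw [← dist_eq_norm]; exact Metric.dist_le_diam_of_mem hYcomp.isBounded hy hy'⟩
  obtain ⟨M, hM⟩ : ∃ M : ℝ, ∀ x ∈ X, ∀ y ∈ Y, |L x y| ≤ M := by
    obtain ⟨M, hM⟩ := (hXcomp.prod hYcomp).exists_bound_of_continuousOn
      hLdiff.continuous.continuousOn
    exact ⟨M, fun x hx y hy => hM (x, y) ⟨hx, hy⟩⟩
  have hM0 : 0 ≤ M := (abs_nonneg _).trans (hM x₀ hx₀ y₀ hy₀)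
  set m := Lyx * DX with hm
  have hm0 : 0 ≤ m := by positivity
  set B := m + Lyy + 2 with hB
  have hB0 : 0 ≤ B := by positivity
  set C' := B / 2 * (m * (Lyy + 2)) + m ^ 2 + Lxx / 2 * DX ^ 2 + DY with hC'
  set W := 2 * M + DY ^ 2 / 2 + B / 2 * (Lyy + 2) * DY with hW
  refine ⟨C' + 3 * W + 1, by positivity, ?_⟩
  intro K hK xs ys s hx0 hy0 hs hxs hys
  have hK0 : (0 : ℝ) < K := by positivity
  set ε := (K : ℝ) ^ (-(1 : ℝ) / 4) with hε
  have hε0 : 0 < ε := Real.rpow_pos_of_pos hK0 _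
  have hε1 : ε ≤ 1 := Real.rpow_le_one_of_one_le_of_nonpos
    (by exact_mod_cast (by omega : 1 ≤ K)) (by norm_num)
  have hτ : (K : ℝ) ^ (-(3 : ℝ) / 4) = ε ^ 3 := by
    rw [hε, ← Real.rpow_natCast, ← Real.rpow_mul hK0.le]
    norm_num
  have hKε : K * ε ^ 4 = 1 := by
    rw [hε, ← Real.rpow_natCast, ← Real.rpow_mul hK0.le]
    norm_num [Real.rpow_neg_one, hK0.ne']
  rw [hτ] at hxs
  set σ := 2 / (Lyy + 2 * ε) with hσ
  have hσ0 : 0 < σ := by positivity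
  have hτ1 : ε ^ 3 ≤ 1 := pow_le_one₀ hε0.le hε1
  have hmemX : ∀ k ≤ K, xs k ∈ X := by
    intro k
    induction k with
    | zero => intro _; rwa [hx0]
    | succ k ih =>
      intro hk
      rw [hxs k hk]
      exact hXconv (hs k hk).1 (ih (by omega)) (by positivity) (by linarith) (by ring)
  have hmemY : ∀ k ≤ K, ys k ∈ Y := by
    intro k hk
    cases k with
    | zero => rwa [hy0]
    | succ k => rw [hys k hk]; exact (hP _).1
  have hex : ∀ x ∈ X, ∃ b ∈ Y, IsMaxOn (fun y => L x y - ε / 2 * ‖y - y₀‖ ^ 2) Y b := by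
    intro x _
    have hc : Continuous (L x) := hLdiff.continuous.comp (by fun_prop : Continuous fun y => (x, y))
    exact hYcomp.exists_isMaxOn hYne (by fun_prop)
  choose! sol hsolY hsol using hex
  set b : ℕ → F := fun k => sol (xs k) with hb
  have hbY : ∀ k ≤ K, b k ∈ Y := fun k hk => hsolY _ (hmemX k hk)
  have hbopt : ∀ k ≤ K, ∀ z ∈ Y, ⟪gradY L (xs k) (b k) - ε • (b k - y₀), z - b k⟫ ≤ 0 :=
    fun k hk z hz => inner_le_zero_of_isMaxOn_regularized hYconv (hgY _ _)
      (hsol _ (hmemX k hk)) (hbY k hk) hz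
  set δ : ℕ → ℝ := fun k => ‖ys k - b k‖ with hδ
  set Φ : ℕ → ℝ := fun k => L (xs k) (b k) - ε / 2 * ‖b k - y₀‖ ^ 2 with hΦ
  have hcontr : ∀ k < K, ‖ys (k + 1) - b k‖ ≤ Lyy / (Lyy + 2 * ε) * δ k := by
    intro k hk
    have hX := hmemX k hk.le
    refine norm_sub_le_of_projected_gradient_step hYconv (hconv _ hX) (hgY' _) hLyy
      (hlY _ hX) hε0 y₀ (hmemY k hk.le) (hmemY (k + 1) hk) (hbY k hk.le) ?_ ?_
    · rw [hys k hk, neg_neg]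
      exact (hP _).2 _ (hbY k hk.le)
    · rw [neg_neg]
      exact hbopt k hk.le _ (hmemY (k + 1) hk)
  have hxdiff : ∀ k < K, xs (k + 1) - xs k = ε ^ 3 • (s k - xs k) := by
    intro k hk
    rw [hxs k hk]
    module
  have hxnorm : ∀ k < K, ‖xs (k + 1) - xs k‖ ≤ ε ^ 3 * DX := by
    intro k hk
    rw [hxdiff k hk, norm_smul, Real.norm_of_nonneg (by positivity)]
    gcongr
    exact hDX _ (hs k hk).1 _ (hmemX k hk.le)
  have hsoldiff : ∀ k < K, ‖b k - b (k + 1)‖ ≤ m * ε ^ 2 := by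
    intro k hk
    have hX := hmemX k hk.le
    have h := norm_sub_le_of_variational_inequality_s16 (G₁ := gradY L (xs k))
      (G₂ := gradY L (xs (k + 1))) (m := Lyx * (ε ^ 3 * DX))
      (hbopt k hk.le _ (hbY (k + 1) hk)) (hbopt (k + 1) hk _ (hbY k hk.le))
      (by
        have h1 := (hconv _ hX).add_inner_gradient_le (hgY' _ (b k)) (b (k + 1))
        have h2 := (hconv _ hX).add_inner_gradient_le (hgY' _ (b (k + 1))) (b k)
        rw [← neg_sub (b (k + 1)), inner_neg_right] at h2
        rw [inner_neg_left] at h1 h2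
        rw [inner_sub_left]
        linarith)
      (by
        have h1 := hlipy _ hX _ (hmemX (k + 1) hk) _ (hbY (k + 1) hk) _ (hbY (k + 1) hk)
        rw [sub_self (b (k + 1)), norm_zero, mul_zero, add_zero, norm_sub_rev (xs k)] at h1
        exact h1.trans (by gcongr; exact hxnorm k hk))
    refine le_of_mul_le_mul_left (h.trans_eq ?_) hε0
    rw [hm]; ring
  have hδstep : ∀ k < K,
      2 * ε * δ k ≤ (Lyy + 2 * ε) * (δ k - δ (k + 1)) + m * (Lyy + 2) * ε ^ 2 := by
    intro k hk
    have h1 : δ (k + 1) ≤ Lyy / (Lyy + 2 * ε) * δ k + m * ε ^ 2 :=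
      (norm_sub_le_norm_sub_add_norm_sub _ (b k) _).trans
        (add_le_add (hcontr k hk) (hsoldiff k hk))
    have h2 : (Lyy + 2 * ε) * δ (k + 1) ≤ Lyy * δ k + (Lyy + 2 * ε) * (m * ε ^ 2) := by
      calc _ ≤ (Lyy + 2 * ε) * (Lyy / (Lyy + 2 * ε) * δ k + m * ε ^ 2) := by gcongr
        _ = _ := by field_simp
    have h3 : (Lyy + 2 * ε) * (m * ε ^ 2) ≤ (Lyy + 2) * (m * ε ^ 2) := by gcongr; linarith
    linarith
  have hΦstep : ∀ k < K, ε ^ 3 * ⟪gradX L (xs k) (ys k), xs k - s k⟫ ≤ Φ k - Φ (k + 1)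
      + ε ^ 3 * m * (δ k + m * ε ^ 2) + Lxx / 2 * (ε ^ 3 * DX) ^ 2 := by
    intro k hk
    have hX := hmemX k hk.le
    have h1 := le_add_inner_gradient_add_sq hXconv (hgX (b (k + 1)))
      (hlX _ (hbY (k + 1) hk)) hX (hmemX (k + 1) hk)
    have h2 : L (xs k) (b (k + 1)) - ε / 2 * ‖b (k + 1) - y₀‖ ^ 2 ≤ Φ k :=
      hsol _ hX (hbY (k + 1) hk)
    have h3 := real_inner_le_norm (gradX L (xs k) (b (k + 1)) - gradX L (xs k) (ys k))
      (xs (k + 1) - xs k)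
    have h4 : ‖gradX L (xs k) (b (k + 1)) - gradX L (xs k) (ys k)‖ ≤ Lyx * (δ k + m * ε ^ 2) := by
      have h5 := hlipx _ hX _ hX _ (hbY (k + 1) hk) _ (hmemY k hk.le)
      rw [sub_self (xs k), norm_zero, mul_zero, zero_add, norm_sub_rev (b (k + 1))] at h5
      refine h5.trans ?_
      gcongr
      exact (norm_sub_le_norm_sub_add_norm_sub _ (b k) _).trans
        (by gcongr; exact hsoldiff k hk)
    have h6 : ‖gradX L (xs k) (b (k + 1)) - gradX L (xs k) (ys k)‖ * ‖xs (k + 1) - xs k‖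
        ≤ (Lyx * (δ k + m * ε ^ 2)) * (ε ^ 3 * DX) :=
      mul_le_mul h4 (hxnorm k hk) (norm_nonneg _) ((norm_nonneg _).trans h4)
    have h7 : Lxx / 2 * ‖xs (k + 1) - xs k‖ ^ 2 ≤ Lxx / 2 * (ε ^ 3 * DX) ^ 2 := by
      gcongr; exact hxnorm k hk
    have h8 : ⟪gradX L (xs k) (ys k), xs (k + 1) - xs k⟫
        = - (ε ^ 3 * ⟪gradX L (xs k) (ys k), xs k - s k⟫) := by
      rw [hxdiff k hk, inner_smul_right, ← neg_sub (xs k), inner_neg_right, mul_neg]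
    rw [inner_sub_left, h8] at h3
    have h9 : Φ (k + 1) = L (xs (k + 1)) (b (k + 1)) - ε / 2 * ‖b (k + 1) - y₀‖ ^ 2 := rfl
    have h10 : (Lyx * (δ k + m * ε ^ 2)) * (ε ^ 3 * DX) = ε ^ 3 * m * (δ k + m * ε ^ 2) := by
      rw [hm]; ring
    linarith
  have hgapX : ∀ k < K, sSup ((fun x' => ⟪gradX L (xs k) (ys k), xs k - x'⟫) '' X)
      ≤ ⟪gradX L (xs k) (ys k), xs k - s k⟫ := by
    intro k hk
    refine csSup_le (hXne.image _) ?_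
    rintro _ ⟨x, hx, rfl⟩
    have := (hs k hk).2 x hx
    simp only [inner_sub_right]
    linarith
  have hgapY : ∀ k < K, 1 / σ * ‖ys k - P (ys k + σ • gradY L (xs k) (ys k))‖
      ≤ (Lyy + 2) * δ k + ε * DY := by
    intro k hk
    have h1 : ‖ys (k + 1) - b k‖ ≤ δ k := (hcontr k hk).trans
      (mul_le_of_le_one_left (norm_nonneg _) (by rw [div_le_one (by positivity)]; linarith))
    have h2 : ‖ys (k + 1) - P (ys k + σ • gradY L (xs k) (ys k))‖ ≤ σ * (ε * DY) := by
      rw [hys k hk]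
      refine (norm_sub_le_of_isProjection hP _ _).trans ?_
      rw [add_sub_add_left_eq_sub, ← smul_sub, sub_sub_cancel_left, norm_smul, norm_neg, norm_smul,
        Real.norm_of_nonneg hσ0.le, Real.norm_of_nonneg hε0.le]
      gcongr
      exact hDY _ (hmemY k hk.le) _ hy₀
    have h3 : ‖ys k - P (ys k + σ • gradY L (xs k) (ys k))‖ ≤ 2 * δ k + σ * (ε * DY) := by
      have h4 := norm_sub_le_norm_sub_add_norm_sub (ys k) (ys (k + 1))
        (P (ys k + σ • gradY L (xs k) (ys k)))
      have h5 := norm_sub_le_norm_sub_add_norm_sub (ys k) (b k) (ys (k + 1))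
      rw [norm_sub_rev (b k)] at h5
      have h6 : ‖ys k - b k‖ = δ k := rfl
      linarith
    calc _ ≤ 1 / σ * (2 * δ k + σ * (ε * DY)) := by gcongr
      _ = (Lyy + 2 * ε) * δ k + ε * DY := by rw [hσ]; field_simp
      _ ≤ (Lyy + 2 * 1) * δ k + ε * DY := by
        gcongr
      _ = _ := by ring
  refine exists_gap_le_of_potential (V := fun k => Φ k + B * ε ^ 2 / 2 * (Lyy + 2 * ε) * δ k)
    hK hε0 hKε ?_ ?_
  · intro k hk
    have h1 := mul_le_mul_of_nonneg_left (add_le_add (hgapX k hk) (hgapY k hk))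
      (pow_pos hε0 3).le
    have h2 := hΦstep k hk
    have h3 := mul_le_mul_of_nonneg_left (hδstep k hk) (by positivity : 0 ≤ B * ε ^ 2 / 2)
    have h4 : m ^ 2 * ε ^ 5 ≤ m ^ 2 * ε ^ 4 := by
      gcongr ?_ * ?_
      exact pow_le_pow_of_le_one hε0.le hε1 (by norm_num)
    have h5 : Lxx / 2 * DX ^ 2 * ε ^ 6 ≤ Lxx / 2 * DX ^ 2 * ε ^ 4 := by
      gcongr ?_ * ?_
      exact pow_le_pow_of_le_one hε0.le hε1 (by norm_num)
    refine h1.trans ?_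
    rw [hC']
    have h6 : B * ε ^ 3 * δ k = m * ε ^ 3 * δ k + ε ^ 3 * ((Lyy + 2) * δ k) := by rw [hB]; ring
    ring_nf at h2 h3 h4 h5 h6 ⊢
    linarith
  · intro k hk
    have hΦ1 : Φ k ≤ M := by
      have h1 := (abs_le.1 (hM _ (hmemX k hk) _ (hbY k hk))).2
      have h2 : 0 ≤ ε / 2 * ‖b k - y₀‖ ^ 2 := by positivity
      simp only [hΦ]
      linarith
    have hΦ2 : -M - DY ^ 2 / 2 ≤ Φ K := by
      have h1 := (abs_le.1 (hM _ (hmemX K le_rfl) _ (hbY K le_rfl))).1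
      have h2 : ε / 2 * ‖b K - y₀‖ ^ 2 ≤ 1 / 2 * DY ^ 2 := by
        gcongr
        exact hDY _ (hbY K le_rfl) _ hy₀
      simp only [hΦ]
      linarith
    have h3 : B * ε ^ 2 / 2 * (Lyy + 2 * ε) * δ k ≤ B * 1 / 2 * (Lyy + 2 * 1) * DY := by
      gcongr
      · exact pow_le_one₀ hε0.le hε1
      · exact hDY _ (hmemY k hk) _ (hbY k hk)
    have h4 : 0 ≤ B * ε ^ 2 / 2 * (Lyy + 2 * ε) * δ K :=
      mul_nonneg (by positivity) (norm_nonneg _)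
    simp only [hW]
    linarith
end
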